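/- arXiv:1501.01695 — 4 statements merged into one kernel-verified Lean document; each statement's English description precedes it below -/
import Mathlib

section
/- Let Y₁,…,Y_m be i.i.d. standard normal random variables. Then for every nonempty subset S ⊆ {1,…,m} and every δ > 0: P{ √((1/|S|)Σ_{j∈S} Y_(j)²) < δ + E√((1/|S|)Σ_{j∈S} Y_(j)²) } ≥ 1 − e^{−δ²|S|/2}, and P{ √((1/|S|)Σ_{j∈S} Y_(j)²) > −δ + E√((1/|S|)Σ_{j∈S} Y_(j)²) } ≥ 1 − e^{−δ²|S|/2}. -/
open MeasureTheory ProbabilityTheory Real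

/-- The canonical probability space of `m` i.i.d. standard Gaussian random variables. -/
noncomputable def stdGaussianPi (m : ℕ) : Measure (Fin m → ℝ) :=
  Measure.pi fun _ => gaussianReal 0 1

/-- `absOrd y j = |Y_(j+1)|`: the `(j+1)`-st largest among `|y 0|, …, |y (m-1)|`
(nonincreasing rearrangement in absolute value). -/
noncomputable def absOrd {m : ℕ} (y : Fin m → ℝ) (j : Fin m) : ℝ :=
  |y (Tuple.sort (fun i => -|y i|) j)|

open scoped ENNReal Pointwise

/-- One-dimensional Brunn–Minkowski inequality for compact sets. -/
lemma volume_add_le_of_isCompact {K L C : Set ℝ} (hK : IsCompact K) (hL : IsCompact L)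
    (hK₀ : K.Nonempty) (hL₀ : L.Nonempty) (h : K + L ⊆ C) :
    volume K + volume L ≤ volume C := by
  obtain ⟨a, ha, ha'⟩ := hK.exists_isGreatest hK₀
  obtain ⟨b, hb, hb'⟩ := hL.exists_isLeast hL₀
  have hd : AEDisjoint volume (b +ᵥ K) (a +ᵥ L) := by
    refine measure_mono_null (t := {a + b}) ?_ (by simp)
    rintro _ ⟨⟨x, hx, rfl⟩, ⟨y, hy, hxy⟩⟩
    have := ha' hx
    have := hb' hy
    simp only [vadd_eq_add, Set.mem_singleton_iff] at hxy ⊢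
    linarith
  calc volume K + volume L = volume (b +ᵥ K) + volume (a +ᵥ L) := by
        rw [measure_vadd, measure_vadd]
    _ = volume ((b +ᵥ K) ∪ (a +ᵥ L)) :=
        (measure_union₀ (hL.vadd a).measurableSet.nullMeasurableSet hd).symm
    _ ≤ volume C := by
        refine measure_mono (Set.Subset.trans ?_ h)
        rintro _ (⟨x, hx, rfl⟩ | ⟨x, hx, rfl⟩)
        · exact ⟨x, hx, b, hb, by simp [add_comm]⟩
        · exact ⟨a, ha, x, hx, by simp⟩

/-- One-dimensional Brunn–Minkowski inequality for measurable sets. -/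
lemma volume_add_le_of_measurableSet {A B C : Set ℝ} (hA : MeasurableSet A) (hB : MeasurableSet B)
    (hA₀ : A.Nonempty) (hB₀ : B.Nonempty) (h : A + B ⊆ C) :
    volume A + volume B ≤ volume C := by
  obtain ⟨a, ha⟩ := hA₀
  obtain ⟨b, hb⟩ := hB₀
  rw [hA.measure_eq_iSup_isCompact, hB.measure_eq_iSup_isCompact]
  simp_rw [iSup_and']
  refine ENNReal.biSup_add_biSup_le' ⟨∅, by simp⟩ ⟨∅, by simp⟩ fun K hK L hL => ?_
  calc volume K + volume L ≤ volume (insert a K) + volume (insert b L) := by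
        gcongr <;> exact Set.subset_insert _ _
    _ ≤ volume C :=
        volume_add_le_of_isCompact (hK.2.insert a) (hL.2.insert b) (Set.insert_nonempty _ _)
          (Set.insert_nonempty _ _) ((Set.add_subset_add (Set.insert_subset ha hK.1)
            (Set.insert_subset hb hL.1)).trans h)

lemma lintegral_eq_setLIntegral_meas_lt_of_le_one {f : ℝ → ℝ≥0∞} (hf : Measurable f)
    (h1 : ∀ x, f x ≤ 1) :
    ∫⁻ x, f x = ∫⁻ t in Set.Ioo (0 : ℝ) 1, volume {x | ENNReal.ofReal t < f x} := by
  have hfin : ∀ x, f x ≠ ∞ := fun x => ((h1 x).trans_lt ENNReal.one_lt_top).ne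
  have key := lintegral_eq_lintegral_meas_lt volume (f := fun x => (f x).toReal)
    (.of_forall fun _ => ENNReal.toReal_nonneg) hf.ennreal_toReal.aemeasurable
  simp_rw [ENNReal.ofReal_toReal (hfin _)] at key
  rw [key, ← Set.Ioo_union_Ici_eq_Ioi zero_lt_one,
    lintegral_union measurableSet_Ici (Set.disjoint_left.2 fun x hx hx' => hx.2.not_ge hx')]
  have h0 : ∫⁻ t in Set.Ici (1 : ℝ), volume {x | t < (f x).toReal} = 0 := by
    rw [setLIntegral_congr_fun (g := fun _ => 0) measurableSet_Ici, lintegral_zero]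
    intro t ht
    have : {x | t < (f x).toReal} = ∅ := by
      ext x
      simp only [Set.mem_ofPred_eq, Set.mem_empty_iff_false, iff_false, not_lt]
      exact (ENNReal.toReal_mono ENNReal.one_ne_top (h1 x)).trans (by simpa using ht)
    simp [this]
  rw [h0, add_zero]
  refine setLIntegral_congr_fun measurableSet_Ioo fun t ht => ?_
  simp only [ENNReal.ofReal_lt_iff_lt_toReal ht.1.le (hfin _)]

/-- Prékopa–Leindler on the line for functions whose suprema equal one. -/
lemma add_lintegral_le_of_iSup_eq_one {p q : ℝ} (hp : 0 < p) (hq : 0 < q) (hpq : p + q = 1)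
    {f g h : ℝ → ℝ≥0∞} (hf : Measurable f) (hg : Measurable g) (hh : Measurable h)
    (hf1 : ⨆ x, f x = 1) (hg1 : ⨆ x, g x = 1)
    (H : ∀ x y, f x ^ p * g y ^ q ≤ h (p * x + q * y)) :
    ENNReal.ofReal p * (∫⁻ x, f x) + ENNReal.ofReal q * ∫⁻ x, g x ≤ ∫⁻ x, h x := by
  have hfle : ∀ x, f x ≤ 1 := fun x => hf1 ▸ le_iSup f x
  have hgle : ∀ x, g x ≤ 1 := fun x => hg1 ▸ le_iSup g x
  have meas : ∀ u : ℝ → ℝ≥0∞,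
      Measurable fun t : ℝ => volume {x | ENNReal.ofReal t < u x} := fun u =>
    Antitone.measurable fun s t hst => measure_mono fun x hx =>
      (ENNReal.ofReal_le_ofReal hst).trans_lt hx
  calc ENNReal.ofReal p * (∫⁻ x, f x) + ENNReal.ofReal q * ∫⁻ x, g x
      = ∫⁻ t in Set.Ioo (0 : ℝ) 1, (ENNReal.ofReal p * volume {x | ENNReal.ofReal t < f x} +
          ENNReal.ofReal q * volume {x | ENNReal.ofReal t < g x}) := by
        rw [lintegral_eq_setLIntegral_meas_lt_of_le_one hf hfle,
          lintegral_eq_setLIntegral_meas_lt_of_le_one hg hgle,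
          lintegral_add_left ((meas f).const_mul _), lintegral_const_mul _ (meas f),
          lintegral_const_mul _ (meas g)]
    _ ≤ ∫⁻ t in Set.Ioo (0 : ℝ) 1, volume {x | ENNReal.ofReal t < min (h x) 1} := by
        refine setLIntegral_mono (meas _) fun t ht => ?_
        have ht1 : ENNReal.ofReal t < 1 := by simpa using ht.2
        have hsm : ∀ (r : ℝ) (hr : 0 < r) (s : Set ℝ),
            ENNReal.ofReal r * volume s = volume (r • s) := fun r hr s => by
          rw [Measure.addHaar_smul]; simp [abs_of_pos hr]
        rw [hsm p hp, hsm q hq]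
        refine volume_add_le_of_measurableSet
          ((measurableSet_lt measurable_const hf).const_smul₀ p)
          ((measurableSet_lt measurable_const hg).const_smul₀ q)
          (Set.Nonempty.smul_set ?_) (Set.Nonempty.smul_set ?_) ?_
        · exact lt_iSup_iff.1 (hf1 ▸ ht1)
        · exact lt_iSup_iff.1 (hg1 ▸ ht1)
        · rintro _ ⟨_, ⟨x, hx, rfl⟩, _, ⟨y, hy, rfl⟩, rfl⟩
          refine lt_min (lt_of_lt_of_le ?_ (H x y)) ht1
          have ht0 : ENNReal.ofReal t ≠ 0 := by simpa using ht.1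
          calc ENNReal.ofReal t = ENNReal.ofReal t ^ p * ENNReal.ofReal t ^ q := by
                rw [← ENNReal.rpow_add _ _ ht0 ENNReal.ofReal_ne_top, hpq, ENNReal.rpow_one]
            _ < f x ^ p * g y ^ q :=
                ENNReal.mul_lt_mul (ENNReal.rpow_lt_rpow hx hp) (ENNReal.rpow_lt_rpow hy hq)
    _ = ∫⁻ x, min (h x) 1 :=
        (lintegral_eq_setLIntegral_meas_lt_of_le_one (hh.min measurable_const)
          fun _ => min_le_right _ _).symm
    _ ≤ ∫⁻ x, h x := lintegral_mono fun _ => min_le_left _ _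

/-- The weighted arithmetic-geometric mean inequality in `ℝ≥0∞`. -/
lemma ENNReal.rpow_mul_rpow_le_add {p q : ℝ} (hp : 0 < p) (hq : 0 < q) (hpq : p + q = 1)
    (a b : ℝ≥0∞) : a ^ p * b ^ q ≤ ENNReal.ofReal p * a + ENNReal.ofReal q * b := by
  rcases eq_or_ne a ∞ with rfl | ha
  · simp [ENNReal.mul_top, hp]
  rcases eq_or_ne b ∞ with rfl | hb
  · simp [ENNReal.mul_top, hq]
  lift a to NNReal using ha
  lift b to NNReal using hb
  have := NNReal.geom_mean_le_arith_mean2_weighted p.toNNReal q.toNNReal a b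
    (by rw [← Real.toNNReal_add hp.le hq.le, hpq, Real.toNNReal_one])
  rw [Real.coe_toNNReal _ hp.le, Real.coe_toNNReal _ hq.le] at this
  rw [← ENNReal.coe_rpow_of_nonneg _ hp.le, ← ENNReal.coe_rpow_of_nonneg _ hq.le]
  simpa [ENNReal.ofReal] using ENNReal.coe_le_coe.2 this

/-- The **Prékopa–Leindler inequality** on the line for bounded functions. -/
lemma prekopaLeindler_of_iSup_ne_top {p q : ℝ} (hp : 0 < p) (hq : 0 < q) (hpq : p + q = 1)
    {f g h : ℝ → ℝ≥0∞} (hf : Measurable f) (hg : Measurable g) (hh : Measurable h)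
    (hf1 : ⨆ x, f x ≠ ∞) (hg1 : ⨆ x, g x ≠ ∞)
    (H : ∀ x y, f x ^ p * g y ^ q ≤ h (p * x + q * y)) :
    (∫⁻ x, f x) ^ p * (∫⁻ x, g x) ^ q ≤ ∫⁻ x, h x := by
  set a := ⨆ x, f x with ha
  set b := ⨆ x, g x with hb
  rcases eq_or_ne a 0 with ha0 | ha0
  · have : f = 0 := funext fun x => le_antisymm ((le_iSup f x).trans_eq ha0) zero_le
    simp [this, hp]
  rcases eq_or_ne b 0 with hb0 | hb0
  · have : g = 0 := funext fun x => le_antisymm ((le_iSup g x).trans_eq hb0) zero_le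
    simp [this, hq]
  set c := a ^ p * b ^ q with hc
  have hap : a ^ p ≠ 0 := by simp [ha0, hf1]
  have hbq : b ^ q ≠ 0 := by simp [hb0, hg1]
  have hap' : a ^ p ≠ ∞ := ENNReal.rpow_ne_top_of_nonneg hp.le hf1
  have hbq' : b ^ q ≠ ∞ := ENNReal.rpow_ne_top_of_nonneg hq.le hg1
  have hc0 : c ≠ 0 := mul_ne_zero hap hbq
  have hct : c ≠ ∞ := ENNReal.mul_ne_top hap' hbq'
  have key : ∀ u v : ℝ≥0∞, (a⁻¹ * u) ^ p * (b⁻¹ * v) ^ q = c⁻¹ * (u ^ p * v ^ q) := fun u v => by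
    rw [ENNReal.mul_rpow_of_nonneg _ _ hp.le, ENNReal.mul_rpow_of_nonneg _ _ hq.le,
      ENNReal.inv_rpow, ENNReal.inv_rpow, hc, ENNReal.mul_inv (.inl hap) (.inl hap')]
    ring
  have h1 := add_lintegral_le_of_iSup_eq_one hp hq hpq (hf.const_mul a⁻¹) (hg.const_mul b⁻¹)
    (hh.const_mul c⁻¹) (by rw [← ENNReal.mul_iSup, ← ha, ENNReal.inv_mul_cancel ha0 hf1])
    (by rw [← ENNReal.mul_iSup, ← hb, ENNReal.inv_mul_cancel hb0 hg1])
    (fun x y => by rw [key]; gcongr; exact H x y)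
  have h2 := (ENNReal.rpow_mul_rpow_le_add hp hq hpq _ _).trans h1
  rw [lintegral_const_mul _ hf, lintegral_const_mul _ hg, lintegral_const_mul _ hh, key] at h2
  exact (ENNReal.mul_le_mul_iff_right (ENNReal.inv_ne_zero.2 hct) (ENNReal.inv_ne_top.2 hc0)).1 h2

/-- The **Prékopa–Leindler inequality** on the line. -/
theorem prekopaLeindler_real {p q : ℝ} (hp : 0 < p) (hq : 0 < q) (hpq : p + q = 1)
    {f g h : ℝ → ℝ≥0∞} (hf : Measurable f) (hg : Measurable g) (hh : Measurable h)
    (H : ∀ x y, f x ^ p * g y ^ q ≤ h (p * x + q * y)) :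
    (∫⁻ x, f x) ^ p * (∫⁻ x, g x) ^ q ≤ ∫⁻ x, h x := by
  rcases eq_or_ne (∫⁻ x, f x) 0 with hf0 | hf0
  · simp [hf0, hp]
  rcases eq_or_ne (∫⁻ x, g x) 0 with hg0 | hg0
  · simp [hg0, hq]
  have trunc : ∀ u : ℝ → ℝ≥0∞, Measurable u →
      Filter.Tendsto (fun n : ℕ => ∫⁻ x, min (u x) n) Filter.atTop (nhds (∫⁻ x, u x)) := by
    intro u hu
    refine lintegral_tendsto_of_tendsto_of_monotone
      (fun n => (hu.min measurable_const).aemeasurable)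
      (.of_forall fun x m n hmn => min_le_min le_rfl (by exact_mod_cast hmn))
      (.of_forall fun x => ?_)
    simpa using (tendsto_const_nhds (x := u x)).min ENNReal.tendsto_nat_nhds_top
  have bdd : ∀ (u : ℝ → ℝ≥0∞) (n : ℕ), ⨆ x, min (u x) n ≠ ∞ := fun u n =>
    ((iSup_le fun x => min_le_right _ _).trans_lt (ENNReal.natCast_lt_top n)).ne
  refine le_of_tendsto (ENNReal.Tendsto.mul ((ENNReal.continuous_rpow_const.tendsto _).comp
    (trunc f hf)) (.inl ?_) ((ENNReal.continuous_rpow_const.tendsto _).comp (trunc g hg))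
    (.inl ?_)) (.of_forall fun n => prekopaLeindler_of_iSup_ne_top hp hq hpq
      (hf.min measurable_const) (hg.min measurable_const) hh (bdd f n) (bdd g n)
      fun x y => le_trans ?_ (H x y))
  · simp [hf0, hp.le, hp]
  · simp [hg0, hq.le, hq]
  · gcongr <;> exact min_le_left _ _

lemma gaussianReal_rpow_mul_rpow_le {p q : ℝ} (hp : 0 < p) (hq : 0 < q) (hpq : p + q = 1)
    {C : ℝ≥0∞} {f g : ℝ → ℝ≥0∞} (hf : Measurable f) (hg : Measurable g)
    (H : ∀ x y, f x ^ p * g y ^ q ≤ C * ENNReal.ofReal (exp (p * q / 2 * (x - y) ^ 2))) :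
    (∫⁻ x, f x ∂gaussianReal 0 1) ^ p * (∫⁻ x, g x ∂gaussianReal 0 1) ^ q ≤ C := by
  set φ := gaussianPDF 0 1
  have hφ : Measurable φ := measurable_gaussianPDF 0 1
  rw [gaussianReal_of_var_ne_zero 0 one_ne_zero, lintegral_withDensity_eq_lintegral_mul _ hφ hf,
    lintegral_withDensity_eq_lintegral_mul _ hφ hg]
  have hpdf : ∀ x y, ENNReal.ofReal (exp (p * q / 2 * (x - y) ^ 2)) * (φ x ^ p * φ y ^ q) =
      φ (p * x + q * y) := by
    intro x y
    have hc : 0 < (√(2 * π))⁻¹ := by positivity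
    simp only [φ, gaussianPDF, gaussianPDFReal, NNReal.coe_one, mul_one, sub_zero]
    rw [ENNReal.ofReal_rpow_of_nonneg (by positivity) hp.le,
      ENNReal.ofReal_rpow_of_nonneg (by positivity) hq.le, ← ENNReal.ofReal_mul (by positivity),
      ← ENNReal.ofReal_mul (by positivity), mul_rpow hc.le (exp_pos _).le,
      mul_rpow hc.le (exp_pos _).le, ← exp_mul, ← exp_mul, mul_mul_mul_comm, ← rpow_add hc, hpq,
      rpow_one, mul_left_comm, ← exp_add, ← exp_add]
    congr 3
    obtain rfl : q = 1 - p := by linarith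
    ring
  have := prekopaLeindler_real hp hq hpq (hφ.mul hf) (hφ.mul hg) (hφ.const_mul C) (fun x y => by
    calc (φ * f) x ^ p * (φ * g) y ^ q = (f x ^ p * g y ^ q) * (φ x ^ p * φ y ^ q) := by
          simp only [Pi.mul_apply]
          rw [ENNReal.mul_rpow_of_nonneg _ _ hp.le, ENNReal.mul_rpow_of_nonneg _ _ hq.le]
          ring
      _ ≤ C * ENNReal.ofReal (exp (p * q / 2 * (x - y) ^ 2)) * (φ x ^ p * φ y ^ q) := by
          exact mul_le_mul_left (H x y) _
      _ = C * φ (p * x + q * y) := by rw [mul_assoc, hpdf])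
  refine this.trans_eq ?_
  rw [lintegral_const_mul _ hφ, lintegral_gaussianPDF_eq_one 0 one_ne_zero, mul_one]

lemma lintegral_pi_fin_succ {n : ℕ} (ν : Measure ℝ) [SigmaFinite ν]
    {f : (Fin (n + 1) → ℝ) → ℝ≥0∞} (hf : Measurable f) :
    ∫⁻ x, f x ∂(Measure.pi fun _ => ν) =
      ∫⁻ a, ∫⁻ x, f (Fin.cons a x) ∂(Measure.pi fun _ : Fin n => ν) ∂ν := by
  have e := (measurePreserving_piFinSuccAbove (fun _ : Fin (n + 1) => ν) 0).symm
  rw [← e.lintegral_comp hf]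
  refine (lintegral_prod _ (hf.comp e.measurable).aemeasurable).trans ?_
  simp [MeasurableEquiv.piFinSuccAbove, Fin.insertNthEquiv]

lemma measurable_lintegral_fin_cons {n : ℕ} (ν : Measure ℝ) [SigmaFinite ν]
    {f : (Fin (n + 1) → ℝ) → ℝ≥0∞} (hf : Measurable f) :
    Measurable fun a => ∫⁻ x, f (Fin.cons a x) ∂(Measure.pi fun _ : Fin n => ν) := by
  have hc : Measurable fun z : ℝ × (Fin n → ℝ) => (Fin.cons z.1 z.2 : Fin (n + 1) → ℝ) := by
    refine measurable_pi_iff.2 fun i => ?_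
    refine Fin.cases ?_ (fun j => ?_) i
    · simpa using measurable_fst
    · simp only [Fin.cons_succ]
      fun_prop
  exact Measurable.lintegral_prod_right' (hf.comp hc)

/-- The Prékopa–Leindler inequality for the standard Gaussian measure. -/
theorem pi_gaussianReal_rpow_mul_rpow_le {p q : ℝ} (hp : 0 < p) (hq : 0 < q) (hpq : p + q = 1)
    {n : ℕ} {C : ℝ≥0∞} {f g : (Fin n → ℝ) → ℝ≥0∞} (hf : Measurable f) (hg : Measurable g)
    (H : ∀ x y, f x ^ p * g y ^ q ≤
      C * ENNReal.ofReal (exp (p * q / 2 * ∑ i, (x i - y i) ^ 2))) :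
    (∫⁻ x, f x ∂(Measure.pi fun _ => gaussianReal 0 1)) ^ p *
      (∫⁻ x, g x ∂(Measure.pi fun _ => gaussianReal 0 1)) ^ q ≤ C := by
  induction n generalizing C with
  | zero =>
    rw [Measure.pi_of_empty _ 0, lintegral_dirac' _ hf, lintegral_dirac' _ hg]
    simpa using H 0 0
  | succ n ih =>
    have hcons : ∀ a : ℝ, Measurable fun x : Fin n → ℝ => (Fin.cons a x : Fin (n + 1) → ℝ) :=
      fun a => measurable_pi_iff.2 fun i => Fin.cases (by simp)
        (fun j => by simpa using measurable_pi_apply j) i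
    rw [lintegral_pi_fin_succ _ hf, lintegral_pi_fin_succ _ hg]
    refine gaussianReal_rpow_mul_rpow_le hp hq hpq (measurable_lintegral_fin_cons _ hf)
      (measurable_lintegral_fin_cons _ hg) fun a b => ?_
    refine ih (hf.comp (hcons a)) (hg.comp (hcons b)) fun x y => ?_
    refine (H _ _).trans_eq ?_
    rw [Fin.sum_univ_succ, mul_add, exp_add, ENNReal.ofReal_mul (exp_pos _).le, mul_assoc]
    simp

lemma ofReal_exp_integral_le_lintegral {Ω : Type*} [MeasurableSpace Ω] {μ : Measure Ω}
    [IsProbabilityMeasure μ] {f : Ω → ℝ} (hf : Integrable f μ) :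
    ENNReal.ofReal (exp (∫ x, f x ∂μ)) ≤ ∫⁻ x, ENNReal.ofReal (exp (f x)) ∂μ := by
  by_cases h : Integrable (fun x => exp (f x)) μ
  · rw [← ofReal_integral_eq_lintegral_ofReal h (.of_forall fun _ => (exp_pos _).le)]
    exact ENNReal.ofReal_le_ofReal (convexOn_exp.map_integral_le continuous_exp.continuousOn
      isClosed_univ (.of_forall fun _ => Set.mem_univ _) hf h)
  · have hm : AEStronglyMeasurable (fun x => exp (f x)) μ :=
      continuous_exp.comp_aestronglyMeasurable hf.1
    have : ∫⁻ x, ENNReal.ofReal (exp (f x)) ∂μ = ∞ := by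
      by_contra hne
      exact h ((lintegral_ofReal_ne_top_iff_integrable hm
        (.of_forall fun _ => (exp_pos _).le)).1 hne)
    simp [this]

/-- **Gaussian concentration**: a function with Lipschitz constant `L` for the Euclidean distance
deviates above its mean by `δ` with probability at most `exp (-δ² / (2 L²))`. -/
theorem pi_gaussianReal_le_of_lipschitz {n : ℕ} {f : (Fin n → ℝ) → ℝ} {L δ : ℝ} (hL : 0 < L)
    (hδ : 0 < δ) (hfm : Measurable f)
    (hfi : Integrable f (Measure.pi fun _ => gaussianReal 0 1))
    (hf : ∀ x y, f x - f y ≤ L * √(∑ i, (x i - y i) ^ 2)) :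
    Measure.pi (fun _ => gaussianReal 0 1)
        {x | δ + ∫ z, f z ∂(Measure.pi fun _ => gaussianReal 0 1) ≤ f x} ≤
      ENNReal.ofReal (exp (-(δ ^ 2 / (2 * L ^ 2)))) := by
  set μ : Measure (Fin n → ℝ) := Measure.pi fun _ => gaussianReal 0 1
  set M := ∫ z, f z ∂μ with hM
  set l := δ / L ^ 2 with hl
  have hl0 : 0 < l := by positivity
  have key : ∀ s ∈ Set.Ioo (0 : ℝ) 1, μ {x | δ + M ≤ f x} ≤
      ENNReal.ofReal (exp (-((1 - s) * (δ ^ 2 / (2 * L ^ 2))))) := by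
    rintro s ⟨hs0, hs1⟩
    have hp : 0 < 1 - s := by linarith
    have h1 := pi_gaussianReal_rpow_mul_rpow_le (n := n) hp hs0 (by ring)
      (C := ENNReal.ofReal (exp (s * (1 - s) * (l ^ 2 * L ^ 2 / 2))))
      (f := fun x => ENNReal.ofReal (exp (-(s * l) * f x)))
      (g := fun x => ENNReal.ofReal (exp ((1 - s) * l * f x)))
      (by fun_prop) (by fun_prop) (fun x y => by
        rw [ENNReal.ofReal_rpow_of_pos (exp_pos _), ENNReal.ofReal_rpow_of_pos (exp_pos _),
          ← ENNReal.ofReal_mul (by positivity), ← ENNReal.ofReal_mul (by positivity),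
          ← exp_mul, ← exp_mul, ← exp_add, ← exp_add]
        refine ENNReal.ofReal_le_ofReal (exp_le_exp.2 ?_)
        have h := hf y x
        have hsymm : ∑ i, (y i - x i) ^ 2 = ∑ i, (x i - y i) ^ 2 :=
          Finset.sum_congr rfl fun i _ => by ring
        rw [hsymm] at h
        set D := ∑ i, (x i - y i) ^ 2
        have hD : √D ^ 2 = D := sq_sqrt (Finset.sum_nonneg fun _ _ => sq_nonneg _)
        have h2 : l * (f y - f x) ≤ l ^ 2 * L ^ 2 / 2 + D / 2 := by
          nlinarith [sq_nonneg (l * L - √D), mul_le_mul_of_nonneg_left h hl0.le]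
        nlinarith [mul_le_mul_of_nonneg_left h2 (mul_pos hs0 hp).le])
    have h2 := ofReal_exp_integral_le_lintegral (hfi.const_mul (-(s * l)))
    rw [integral_const_mul, ← hM] at h2
    have h3 := mul_meas_ge_le_lintegral (μ := μ)
      (f := fun x => ENNReal.ofReal (exp ((1 - s) * l * f x))) (by fun_prop)
      (ENNReal.ofReal (exp ((1 - s) * l * (δ + M))))
    have hset : {x | ENNReal.ofReal (exp ((1 - s) * l * (δ + M))) ≤
        ENNReal.ofReal (exp ((1 - s) * l * f x))} = {x | δ + M ≤ f x} := by
      ext x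
      simp only [Set.mem_ofPred_eq]
      rw [ENNReal.ofReal_le_ofReal_iff (exp_pos _).le, exp_le_exp,
        mul_le_mul_iff_right₀ (by positivity)]
    rw [hset] at h3
    have hprob : μ {x | δ + M ≤ f x} ≠ ∞ := measure_ne_top _ _
    set P := (μ {x | δ + M ≤ f x}).toReal with hP
    rw [← ENNReal.ofReal_toReal hprob, ← hP] at h3 ⊢
    have hP0 : 0 ≤ P := ENNReal.toReal_nonneg
    rw [← ENNReal.ofReal_mul (exp_pos _).le] at h3
    have h4 := (mul_le_mul' (ENNReal.rpow_le_rpow h2 hp.le) (ENNReal.rpow_le_rpow h3 hs0.le)).trans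
      h1
    rw [ENNReal.ofReal_rpow_of_nonneg (exp_pos _).le hp.le,
      ENNReal.ofReal_rpow_of_nonneg (by positivity) hs0.le, ← ENNReal.ofReal_mul (by positivity),
      ENNReal.ofReal_le_ofReal_iff (exp_pos _).le, mul_rpow (exp_pos _).le hP0, ← exp_mul,
      ← exp_mul, ← mul_assoc, ← exp_add] at h4
    refine ENNReal.ofReal_le_ofReal ?_
    rw [← Real.rpow_le_rpow_iff hP0 (exp_pos _).le hs0, ← exp_mul]
    have h5 : P ^ s ≤ exp (s * (1 - s) * (l ^ 2 * L ^ 2 / 2) -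
        (-(s * l) * M * (1 - s) + (1 - s) * l * (δ + M) * s)) := by
      rw [exp_sub, le_div_iff₀ (exp_pos _), mul_comm]
      exact h4
    refine h5.trans_eq (congrArg exp ?_)
    rw [hl]
    field_simp
    ring
  have hlim : Filter.Tendsto
      (fun s : ℝ => ENNReal.ofReal (exp (-((1 - s) * (δ ^ 2 / (2 * L ^ 2))))))
      (nhdsWithin 0 (Set.Ioi 0)) (nhds (ENNReal.ofReal (exp (-(δ ^ 2 / (2 * L ^ 2)))))) := by
    have : Continuous fun s : ℝ =>
        ENNReal.ofReal (exp (-((1 - s) * (δ ^ 2 / (2 * L ^ 2))))) :=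
      ENNReal.continuous_ofReal.comp (by fun_prop)
    simpa using (this.tendsto 0).mono_left nhdsWithin_le_nhds
  exact ge_of_tendsto hlim (Filter.mem_of_superset (Ioo_mem_nhdsGT one_pos) key)

lemma antitone_absOrd {m : ℕ} (y : Fin m → ℝ) : Antitone (absOrd y) := fun i j hij => by
  simpa [absOrd] using Tuple.monotone_sort (fun i => -|y i|) hij

lemma sum_absOrd_sq {m : ℕ} (y : Fin m → ℝ) : ∑ j, absOrd y j ^ 2 = ∑ j, y j ^ 2 := by
  simp only [absOrd, sq_abs]
  exact Equiv.sum_comp (Tuple.sort fun i => -|y i|) fun i => y i ^ 2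

lemma sum_abs_mul_abs_le_sum_absOrd {m : ℕ} (x y : Fin m → ℝ) :
    ∑ i, |x i| * |y i| ≤ ∑ j, absOrd x j * absOrd y j := by
  set σ := Tuple.sort fun i => -|x i|
  set τ := Tuple.sort fun i => -|y i|
  have hmv : Monovary (absOrd x) (absOrd y) := (antitone_absOrd x).monovary (antitone_absOrd y)
  refine le_trans (le_of_eq ?_) (hmv.sum_comp_perm_mul_le_sum_mul (σ := σ⁻¹ * τ))
  rw [← Equiv.sum_comp τ]
  refine Finset.sum_congr rfl fun j _ => ?_
  simp [absOrd, σ, τ]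

/-- Nonincreasing rearrangement is a contraction for the Euclidean distance. -/
lemma sum_absOrd_sub_sq_le {m : ℕ} (x y : Fin m → ℝ) :
    ∑ j, (absOrd x j - absOrd y j) ^ 2 ≤ ∑ i, (x i - y i) ^ 2 := by
  have h1 := sum_abs_mul_abs_le_sum_absOrd x y
  have h2 : ∑ i, x i * y i ≤ ∑ i, |x i| * |y i| :=
    Finset.sum_le_sum fun i _ => abs_mul (x i) (y i) ▸ le_abs_self _
  have h3 : ∀ a b : Fin m → ℝ, ∑ i, (a i - b i) ^ 2 =
      ∑ i, a i ^ 2 + ∑ i, b i ^ 2 - 2 * ∑ i, a i * b i := fun a b => by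
    rw [Finset.mul_sum, ← Finset.sum_add_distrib, ← Finset.sum_sub_distrib]
    exact Finset.sum_congr rfl fun i _ => by ring
  rw [h3, h3, sum_absOrd_sq, sum_absOrd_sq]
  linarith

lemma sqrt_sum_sq_sub_sqrt_sum_sq_le {ι : Type*} (S : Finset ι) (a b : ι → ℝ) :
    √(∑ j ∈ S, a j ^ 2) - √(∑ j ∈ S, b j ^ 2) ≤ √(∑ j ∈ S, (a j - b j) ^ 2) := by
  have := norm_sub_norm_le (WithLp.toLp 2 fun j : S => a j) (WithLp.toLp 2 fun j : S => b j)
  simp only [EuclideanSpace.norm_eq, Real.norm_eq_abs, sq_abs, PiLp.sub_apply] at this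
  rwa [Finset.sum_coe_sort S fun j => a j ^ 2, Finset.sum_coe_sort S fun j => b j ^ 2,
    Finset.sum_coe_sort S fun j => (a j - b j) ^ 2] at this

lemma sqrt_mean_absOrd_sub_le {m : ℕ} (S : Finset (Fin m)) (x y : Fin m → ℝ) :
    √((1 / (S.card : ℝ)) * ∑ j ∈ S, absOrd x j ^ 2) -
      √((1 / (S.card : ℝ)) * ∑ j ∈ S, absOrd y j ^ 2) ≤
      √(1 / (S.card : ℝ)) * √(∑ i, (x i - y i) ^ 2) := by
  rw [sqrt_mul (by positivity), sqrt_mul (by positivity), ← mul_sub]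
  refine mul_le_mul_of_nonneg_left ?_ (sqrt_nonneg _)
  refine (sqrt_sum_sq_sub_sqrt_sum_sq_le S _ _).trans (sqrt_le_sqrt ?_)
  exact (Finset.sum_le_sum_of_subset_of_nonneg (Finset.subset_univ S)
    fun _ _ _ => sq_nonneg _).trans (sum_absOrd_sub_sq_le x y)

lemma continuous_of_sub_le_sqrt_sum {m : ℕ} {f : (Fin m → ℝ) → ℝ} {L : ℝ}
    (hf : ∀ x y, f x - f y ≤ L * √(∑ i, (x i - y i) ^ 2)) : Continuous f := by
  refine continuous_iff_continuousAt.2 fun y => tendsto_iff_dist_tendsto_zero.2 ?_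
  have hc : Continuous fun x : Fin m → ℝ => L * √(∑ i, (x i - y i) ^ 2) := by fun_prop
  refine squeeze_zero (fun _ => dist_nonneg) (fun x => ?_) (by simpa using hc.tendsto y)
  have hsymm : ∑ i, (y i - x i) ^ 2 = ∑ i, (x i - y i) ^ 2 :=
    Finset.sum_congr rfl fun i _ => by ring
  rw [Real.dist_eq, abs_sub_le_iff]
  exact ⟨hf x y, hsymm ▸ hf y x⟩

lemma integrable_of_sub_le_sqrt_sum {m : ℕ} {f : (Fin m → ℝ) → ℝ} {L : ℝ} (hL : 0 ≤ L)
    (hf : ∀ x y, f x - f y ≤ L * √(∑ i, (x i - y i) ^ 2)) :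
    Integrable f (Measure.pi fun _ => gaussianReal 0 1) := by
  have hsq : Integrable (fun x : ℝ => x ^ 2) (gaussianReal 0 1) :=
    (memLp_id_gaussianReal (μ := 0) (v := 1) 2).integrable_sq
  have hsum : Integrable (fun x : Fin m → ℝ => ∑ i, x i ^ 2)
      (Measure.pi fun _ => gaussianReal 0 1) :=
    integrable_finsetSum _ fun i _ =>
      integrable_comp_eval (μ := fun _ : Fin m => gaussianReal 0 1) (i := i) hsq
  refine ((integrable_const |f 0|).add (((integrable_const 1).add hsum).const_mul L)).mono'
    (continuous_of_sub_le_sqrt_sum hf).aestronglyMeasurable (.of_forall fun x => ?_)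
  have h1 := hf x 0
  have h2 := hf 0 x
  simp only [Pi.zero_apply, sub_zero, zero_sub, neg_sq] at h1 h2
  have hD : 0 ≤ ∑ i, x i ^ 2 := Finset.sum_nonneg fun _ _ => sq_nonneg _
  have h3 : √(∑ i, x i ^ 2) ≤ 1 + ∑ i, x i ^ 2 := by
    nlinarith [sq_sqrt hD, sq_nonneg (√(∑ i, x i ^ 2) - 1), sqrt_nonneg (∑ i, x i ^ 2)]
  have h4 := mul_le_mul_of_nonneg_left h3 hL
  simp only [Pi.add_apply]
  rw [Real.norm_eq_abs, abs_le]
  constructor <;> linarith [le_abs_self (f 0), neg_abs_le (f 0)]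

lemma ofReal_one_sub_le_of_compl_le {Ω : Type*} [MeasurableSpace Ω] {μ : Measure Ω}
    [IsProbabilityMeasure μ] {A : Set Ω} {r : ℝ} (hA : MeasurableSet A) (hr : 0 ≤ r)
    (h : μ Aᶜ ≤ ENNReal.ofReal r) : ENNReal.ofReal (1 - r) ≤ μ A := by
  rw [ENNReal.ofReal_sub _ hr, ENNReal.ofReal_one, tsub_le_iff_right, ← prob_add_prob_compl (μ := μ) hA]
  gcongr

theorem orderStat_concentration (m : ℕ) (S : Finset (Fin m)) (hS : S.Nonempty)
    (δ : ℝ) (hδ : 0 < δ) :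
    ENNReal.ofReal (1 - Real.exp (-δ ^ 2 * S.card / 2)) ≤
      stdGaussianPi m
        {y | Real.sqrt ((1 / (S.card : ℝ)) * ∑ j ∈ S, absOrd y j ^ 2) <
          δ + ∫ z, Real.sqrt ((1 / (S.card : ℝ)) * ∑ j ∈ S, absOrd z j ^ 2)
            ∂(stdGaussianPi m)} ∧
    ENNReal.ofReal (1 - Real.exp (-δ ^ 2 * S.card / 2)) ≤
      stdGaussianPi m
        {y | -δ + (∫ z, Real.sqrt ((1 / (S.card : ℝ)) * ∑ j ∈ S, absOrd z j ^ 2)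
            ∂(stdGaussianPi m)) <
          Real.sqrt ((1 / (S.card : ℝ)) * ∑ j ∈ S, absOrd y j ^ 2)} := by
  have hlip := sqrt_mean_absOrd_sub_le S
  have hcard : 0 < (S.card : ℝ) := by exact_mod_cast hS.card_pos
  set L := √(1 / (S.card : ℝ)) with hL
  have hL0 : 0 < L := by positivity
  have hexp : -δ ^ 2 * S.card / 2 = -(δ ^ 2 / (2 * L ^ 2)) := by
    rw [hL, sq_sqrt (by positivity)]
    field_simp
  rw [hexp, stdGaussianPi]
  set F : (Fin m → ℝ) → ℝ := fun y => √((1 / (S.card : ℝ)) * ∑ j ∈ S, absOrd y j ^ 2)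
  have hFm : Measurable F := (continuous_of_sub_le_sqrt_sum hlip).measurable
  have hFi : Integrable F (Measure.pi fun _ => gaussianReal 0 1) :=
    integrable_of_sub_le_sqrt_sum hL0.le hlip
  have hlip' : ∀ x y, -F x - -F y ≤ L * √(∑ i, (x i - y i) ^ 2) := fun x y => by
    have hsymm : ∑ i, (y i - x i) ^ 2 = ∑ i, (x i - y i) ^ 2 :=
      Finset.sum_congr rfl fun i _ => by ring
    linarith [hsymm ▸ hlip y x]
  constructor
  · refine ofReal_one_sub_le_of_compl_le (measurableSet_lt hFm measurable_const) (exp_pos _).le ?_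
    refine le_trans (measure_mono fun x hx => ?_)
      (pi_gaussianReal_le_of_lipschitz hL0 hδ hFm hFi hlip)
    simpa only [Set.mem_compl_iff, Set.mem_ofPred_eq, not_lt] using hx
  · refine ofReal_one_sub_le_of_compl_le (measurableSet_lt measurable_const hFm) (exp_pos _).le ?_
    refine le_trans (measure_mono fun x hx => ?_)
      (pi_gaussianReal_le_of_lipschitz hL0 hδ hFm.neg hFi.neg hlip')
    have hx' : F x ≤ -δ + ∫ z, F z ∂(Measure.pi fun _ => gaussianReal 0 1) :=
      not_lt.1 hx
    simp only [Set.mem_ofPred_eq, Pi.neg_apply, integral_neg]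
    linarith
end

section
/- Let Y₁,…,Y_m be i.i.d. standard normal random variables. Then for every 1 ≤ k ≤ m: E√((1/k)Σ_{j=1}^k Y_(j)²) ≤ √(2 ln(em/k)). -/
open MeasureTheory ProbabilityTheory Real

/-- Convexity of `x ↦ cosh (c √x)` on the nonnegative reals, in the form of Jensen's inequality
for a uniform mean of squares. -/
lemma cosh_mul_sqrt_mean_sq_le {ι : Type*} (s : Finset ι) (hs : s.Nonempty) (c : ℝ) (x : ι → ℝ) :
    cosh (c * √((1 / (s.card : ℝ)) * ∑ i ∈ s, x i ^ 2)) ≤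
      (1 / (s.card : ℝ)) * ∑ i ∈ s, cosh (c * x i) := by
  have hcard : (s.card : ℝ) ≠ 0 := by exact_mod_cast hs.card_pos.ne'
  refine hasSum_le (fun n => ?_) (hasSum_cosh _)
    ((hasSum_sum fun i _ => hasSum_cosh (c * x i)).mul_left (1 / (s.card : ℝ)))
  have hmean := pow_arith_mean_le_arith_mean_pow s (fun _ => 1 / (s.card : ℝ)) (fun i => x i ^ 2)
    (fun _ _ => by positivity) (by simp [hcard]) (fun _ _ => sq_nonneg _) n
  rw [← Finset.mul_sum, ← Finset.mul_sum] at hmean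
  rw [mul_pow, pow_mul (√_) 2 n, sq_sqrt (by positivity), ← Finset.sum_div, ← mul_div_assoc]
  refine div_le_div_of_nonneg_right ?_ (by positivity)
  calc c ^ (2 * n) * ((1 / (s.card : ℝ)) * ∑ i ∈ s, x i ^ 2) ^ n
      ≤ c ^ (2 * n) * ((1 / (s.card : ℝ)) * ∑ i ∈ s, (x i ^ 2) ^ n) :=
        mul_le_mul_of_nonneg_left hmean ((even_two_mul n).pow_nonneg c)
    _ = (1 / (s.card : ℝ)) * ∑ i ∈ s, (c * x i) ^ (2 * n) := by
        simp_rw [mul_pow, ← Finset.mul_sum, ← pow_mul]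
        ring

lemma integrable_cosh_mul_gaussianReal (c : ℝ) :
    Integrable (fun x => cosh (c * x)) (gaussianReal 0 1) := by
  simp_rw [cosh_eq, ← neg_mul]
  exact ((integrable_exp_mul_gaussianReal c).add (integrable_exp_mul_gaussianReal (-c))).div_const 2

lemma integral_cosh_mul_gaussianReal (c : ℝ) :
    ∫ x, cosh (c * x) ∂gaussianReal 0 1 = exp (c ^ 2 / 2) := by
  have hexp (t : ℝ) : ∫ x, exp (t * x) ∂gaussianReal 0 1 = exp (t ^ 2 / 2) := by
    simpa [mgf] using congrFun (mgf_id_gaussianReal (μ := 0) (v := 1)) t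
  simp_rw [cosh_eq, ← neg_mul]
  rw [integral_div, integral_add (integrable_exp_mul_gaussianReal c)
    (integrable_exp_mul_gaussianReal (-c)), hexp, hexp, neg_sq]
  ring

lemma sum_cosh_absOrd_le {m : ℕ} (s : Finset (Fin m)) (c : ℝ) (y : Fin m → ℝ) :
    ∑ j ∈ s, cosh (c * absOrd y j) ≤ ∑ i, cosh (c * y i) := by
  have habs (j : Fin m) : cosh (c * absOrd y j) =
      cosh (c * y (Tuple.sort (fun i => -|y i|) j)) := by
    rw [absOrd, ← cosh_abs, abs_mul, abs_abs, ← abs_mul, cosh_abs]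
  simp_rw [habs]
  exact (Finset.sum_le_univ_sum_of_nonneg fun _ => (cosh_pos _).le).trans_eq
    (Equiv.sum_comp (Tuple.sort fun i => -|y i|) fun i => cosh (c * y i))

theorem orderStat_top_sum_bound (m k : ℕ) (hk1 : 1 ≤ k) (hk2 : k ≤ m) :
    (∫ y, Real.sqrt ((1 / (k : ℝ)) *
        ∑ j ∈ Finset.univ.filter (fun j : Fin m => (j : ℕ) < k), absOrd y j ^ 2)
      ∂(stdGaussianPi m)) ≤ Real.sqrt (2 * Real.log (Real.exp 1 * m / k)) := by
  have hk : (1 : ℝ) ≤ k := by exact_mod_cast hk1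
  have hkm : (k : ℝ) ≤ m := by exact_mod_cast hk2
  have hratio : 1 < 2 * (m : ℝ) / k := by rw [lt_div_iff₀ (by linarith)]; linarith
  set L := log (2 * (m : ℝ) / k)
  have hL : 0 < L := log_pos hratio
  set c := √(2 * L)
  have hc : 0 < c := by positivity
  have hc2 : c ^ 2 = 2 * L := sq_sqrt (by positivity)
  have hexpL : exp L = 2 * (m : ℝ) / k := exp_log (by linarith)
  have hcL : c ≤ √(2 * log (exp 1 * m / k)) := by
    have htwo : (2 : ℝ) ≤ exp 1 := by linarith [add_one_le_exp (1 : ℝ)]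
    have hLe : L ≤ log (exp 1 * m / k) := log_le_log (by linarith) (by gcongr)
    exact sqrt_le_sqrt (by linarith)
  refine le_trans ?_ hcL
  set s := Finset.univ.filter (fun j : Fin m => (j : ℕ) < k)
  have hcard : s.card = k := by simp [s, Fin.card_filter_val_lt, hk2]
  have hs : s.Nonempty := Finset.card_pos.mp (by omega)
  have hpoint (y : Fin m → ℝ) : √((1 / (k : ℝ)) * ∑ j ∈ s, absOrd y j ^ 2) ≤
      c⁻¹ * (2 * exp (-c ^ 2) * (1 / k) * ∑ i, cosh (c * y i) + (c ^ 2 - 1)) := by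
    set r := √((1 / (k : ℝ)) * ∑ j ∈ s, absOrd y j ^ 2)
    have hcosh : cosh (c * r) ≤ (1 / k) * ∑ i, cosh (c * y i) := by
      have h := cosh_mul_sqrt_mean_sq_le s hs c (absOrd y)
      rw [hcard] at h
      exact h.trans (mul_le_mul_of_nonneg_left (sum_cosh_absOrd_le s c y) (by positivity))
    have hexp : exp (c * r) ≤ 2 * cosh (c * r) := by
      rw [cosh_eq]
      linarith [exp_pos (-(c * r))]
    have htangent := add_one_le_exp (-c ^ 2 + c * r)
    rw [exp_add] at htangent
    have hbound := mul_le_mul_of_nonneg_left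
      (hexp.trans (mul_le_mul_of_nonneg_left hcosh zero_le_two)) (exp_pos (-c ^ 2)).le
    rw [le_inv_mul_iff₀ hc]
    linarith
  have hint (i : Fin m) : Integrable (fun y : Fin m → ℝ => cosh (c * y i)) (stdGaussianPi m) :=
    integrable_comp_eval (μ := fun _ : Fin m => gaussianReal 0 1)
      (integrable_cosh_mul_gaussianReal c)
  have hval (i : Fin m) :
      ∫ y : Fin m → ℝ, cosh (c * y i) ∂stdGaussianPi m = exp (c ^ 2 / 2) :=
    (integral_comp_eval (μ := fun _ : Fin m => gaussianReal 0 1)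
      (integrable_cosh_mul_gaussianReal c).aestronglyMeasurable).trans
      (integral_cosh_mul_gaussianReal c)
  have : IsProbabilityMeasure (stdGaussianPi m) := by unfold stdGaussianPi; infer_instance
  have hsum := (integrable_finsetSum Finset.univ fun i _ => hint i).const_mul
    (2 * exp (-c ^ 2) * (1 / (k : ℝ)))
  refine (integral_mono_of_nonneg (.of_forall fun _ => sqrt_nonneg _)
    ((hsum.add (integrable_const (c ^ 2 - 1))).const_mul c⁻¹) (.of_forall hpoint)).trans_eq ?_
  have hmass : 2 * exp (-c ^ 2) * (1 / (k : ℝ)) * (m * exp (c ^ 2 / 2)) = 1 := by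
    calc 2 * exp (-c ^ 2) * (1 / (k : ℝ)) * (m * exp (c ^ 2 / 2))
        = exp (-c ^ 2) * (2 * m / k) * exp (c ^ 2 / 2) := by ring
      _ = 1 := by
        rw [← hexpL, ← exp_add, ← exp_add, exp_eq_one_iff]
        linarith
  simp only [Pi.add_apply]
  rw [integral_const_mul, integral_add hsum (integrable_const _), integral_const_mul,
    integral_finsetSum _ fun i _ => hint i]
  simp only [hval, Finset.sum_const, Finset.card_univ, Fintype.card_fin, nsmul_eq_mul, hmass,
    integral_const, probReal_univ, one_smul]
  field_simp
  ring
end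

section
/- Let c > 0 and consider ε_g := sup_{x ≥ 2} (c² ln(2x) − 1)/(x − 1). (a) If c² ln(4/√e) > 1, then ε_g = c² ln 4 − 1 > 0 and the supremum is attained at x = 2. (b) If c² ln(4/√e) ≤ 1, then there is a unique β_g ∈ (0, 1] with β_g e^{−β_g} = 2e^{−1 − 1/c²}; this β_g satisfies 0 < β_g ≤ 1/2, the supremum is attained at x = 1/β_g, and ε_g = (c² ln(2/β_g) − 1)/(1/β_g − 1) = c² β_g > 0. -/
open Real

/-- `ε_g := sup_{x ≥ 2} (c² ln(2x) − 1)/(x − 1)`. -/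
noncomputable def epsSup (c : ℝ) : ℝ :=
  sSup {t : ℝ | ∃ x : ℝ, 2 ≤ x ∧ t = (c ^ 2 * Real.log (2 * x) - 1) / (x - 1)}

theorem epsSup_eq_of_isMax {c x₀ : ℝ} (hx₀ : 2 ≤ x₀)
    (h : ∀ x : ℝ, 2 ≤ x → (c ^ 2 * Real.log (2 * x) - 1) / (x - 1) ≤
      (c ^ 2 * Real.log (2 * x₀) - 1) / (x₀ - 1)) :
    epsSup c = (c ^ 2 * Real.log (2 * x₀) - 1) / (x₀ - 1) := by
  refine IsGreatest.csSup_eq ⟨⟨x₀, hx₀, rfl⟩, ?_⟩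
  rintro t ⟨x, hx, rfl⟩
  exact h x hx

/-- The tangent line bound for `log (2 * x)` at `x = 1 / b`. -/
theorem log_two_mul_le {b x : ℝ} (hb : 0 < b) (hx : 0 < x) :
    Real.log (2 * x) ≤ Real.log (2 / b) + (b * x - 1) := by
  have h := Real.log_le_sub_one_of_pos (mul_pos hb hx)
  rw [Real.log_mul hb.ne' hx.ne'] at h
  rw [Real.log_mul two_ne_zero hx.ne', Real.log_div two_ne_zero hb.ne']
  linarith

theorem log_four_div_sqrt_exp_one :
    Real.log (4 / Real.sqrt (Real.exp 1)) = Real.log 4 - 1 / 2 := by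
  rw [Real.log_div (by norm_num) (by positivity), Real.log_sqrt (Real.exp_pos 1).le,
    Real.log_exp]

theorem strictMonoOn_mul_exp_neg :
    StrictMonoOn (fun b : ℝ => b * Real.exp (-b)) (Set.Ioc 0 1) := by
  intro a ha b hb hab
  have ha0 : 0 < a := ha.1
  have hb0 : 0 < b := hb.1
  have hlog : Real.log a - a < Real.log b - b := by
    have h := Real.log_lt_sub_one_of_pos (div_pos ha0 hb0) (div_lt_one hb0 |>.2 hab).ne
    rw [Real.log_div ha0.ne' hb0.ne'] at h
    have h' : a / b - 1 ≤ a - b := by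
      rw [div_sub_one hb0.ne', div_le_iff₀ hb0]
      nlinarith [hb.2]
    linarith
  have h := Real.exp_lt_exp.2 hlog
  rw [sub_eq_add_neg, sub_eq_add_neg, Real.exp_add, Real.exp_add, Real.exp_log ha0,
    Real.exp_log hb0] at h
  exact h

theorem log_sub_of_mul_exp_neg_eq {b y : ℝ} (hb : 0 < b)
    (h : b * Real.exp (-b) = 2 * Real.exp y) : Real.log b - b = Real.log 2 + y := by
  have h := congrArg Real.log h
  rwa [Real.log_mul hb.ne' (Real.exp_ne_zero _), Real.log_mul two_ne_zero (Real.exp_ne_zero _),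
    Real.log_exp, Real.log_exp, ← sub_eq_add_neg] at h

theorem exists_mul_exp_neg_eq {y : ℝ} (hy : Real.log 4 - 1 / 2 ≤ -1 - y) :
    ∃ b : ℝ, 0 < b ∧ b ≤ 1 / 2 ∧ b * Real.exp (-b) = 2 * Real.exp y := by
  have hend : 2 * Real.exp y ≤ 1 / 2 * Real.exp (-(1 / 2)) := by
    have h : Real.exp (Real.log 4 + y) ≤ Real.exp (-(1 / 2)) :=
      Real.exp_le_exp.2 (by linarith)
    rw [Real.exp_add, Real.exp_log (by norm_num)] at h
    linarith
  have hcont : ContinuousOn (fun b : ℝ => b * Real.exp (-b)) (Set.Icc 0 (1 / 2)) := by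
    fun_prop
  obtain ⟨b, hb, hby⟩ := intermediate_value_Icc (by norm_num) hcont
    (show 2 * Real.exp y ∈ Set.Icc _ _ from ⟨by simp [Real.exp_nonneg], hend⟩)
  refine ⟨b, hb.1.lt_of_ne ?_, hb.2, hby⟩
  rintro rfl
  simp at hby

theorem epsSup_formula (c : ℝ) (hc : 0 < c) :
    (c ^ 2 * Real.log (4 / Real.sqrt (Real.exp 1)) > 1 →
      epsSup c = c ^ 2 * Real.log 4 - 1 ∧ 0 < epsSup c ∧
        (c ^ 2 * Real.log (2 * 2) - 1) / (2 - 1) = epsSup c) ∧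
    (c ^ 2 * Real.log (4 / Real.sqrt (Real.exp 1)) ≤ 1 →
      ∃ b : ℝ, (0 < b ∧ b ≤ 1 ∧ b * Real.exp (-b) = 2 * Real.exp (-1 - 1 / c ^ 2)) ∧
        (∀ b' : ℝ, 0 < b' → b' ≤ 1 →
          b' * Real.exp (-b') = 2 * Real.exp (-1 - 1 / c ^ 2) → b' = b) ∧
        0 < b ∧ b ≤ 1 / 2 ∧
        (c ^ 2 * Real.log (2 * (1 / b)) - 1) / (1 / b - 1) = epsSup c ∧
        epsSup c = (c ^ 2 * Real.log (2 / b) - 1) / (1 / b - 1) ∧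
        epsSup c = c ^ 2 * b ∧ 0 < epsSup c) := by
  have hc2 : 0 < c ^ 2 := by positivity
  rw [log_four_div_sqrt_exp_one]
  constructor
  · intro h
    have hsup : epsSup c = c ^ 2 * Real.log 4 - 1 := by
      have h4 : (c ^ 2 * Real.log (2 * 2) - 1) / (2 - 1) = c ^ 2 * Real.log 4 - 1 := by
        norm_num
      rw [← h4]
      refine epsSup_eq_of_isMax le_rfl fun x hx => ?_
      rw [h4, div_le_iff₀ (by linarith)]
      have hlog := log_two_mul_le (b := 1 / 2) (x := x) (by norm_num) (by linarith)
      norm_num at hlog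
      nlinarith [mul_le_mul_of_nonneg_left hlog hc2.le]
    refine ⟨hsup, by rw [hsup]; linarith, ?_⟩
    rw [hsup]
    norm_num
  · intro h
    have hy : Real.log 4 - 1 / 2 ≤ -1 - (-1 - 1 / c ^ 2) := by
      have h' : Real.log 4 - 1 / 2 ≤ 1 / c ^ 2 := by
        rw [le_div_iff₀ hc2]
        linarith
      linarith
    obtain ⟨b, hb0, hb2, hb⟩ := exists_mul_exp_neg_eq hy
    have hnum : c ^ 2 * Real.log (2 / b) - 1 = c ^ 2 * (1 - b) := by
      have hlog : Real.log (2 / b) = 1 - b + 1 / c ^ 2 := by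
        rw [Real.log_div two_ne_zero hb0.ne']
        linarith [log_sub_of_mul_exp_neg_eq hb0 hb]
      rw [hlog]
      field_simp
      ring
    have hval : (c ^ 2 * Real.log (2 / b) - 1) / (1 / b - 1) = c ^ 2 * b := by
      have h1b : 1 - b ≠ 0 := by linarith
      rw [hnum, div_sub_one hb0.ne']
      field_simp
    have hsup : epsSup c = (c ^ 2 * Real.log (2 * (1 / b)) - 1) / (1 / b - 1) := by
      refine epsSup_eq_of_isMax ((le_div_iff₀ hb0).2 (by linarith)) fun x hx => ?_
      rw [mul_one_div, hval, div_le_iff₀ (by linarith)]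
      have hlog := log_two_mul_le hb0 (show 0 < x by linarith)
      nlinarith [mul_le_mul_of_nonneg_left hlog hc2.le]
    have hsup' := hsup
    rw [mul_one_div] at hsup'
    have hsup_mul : epsSup c = c ^ 2 * b := hsup'.trans hval
    refine ⟨b, ⟨hb0, by linarith, hb⟩, fun b' hb'0 hb'1 hb' => ?_, hb0, hb2, hsup.symm, hsup',
      hsup_mul, by rw [hsup_mul]; positivity⟩
    exact strictMonoOn_mul_exp_neg.injOn ⟨hb'0, hb'1⟩ ⟨hb0, by linarith⟩ (hb'.trans hb.symm)
end

section
/- Let n ∈ ℕ, fix x₀ ∈ ℝ^n with ‖x₀‖ = 1, and for each m ∈ ℕ let A be an m×n Gaussian random matrix. Let 0 < α < 1 and 0 < ε ≤ min(1, 2(1 − √α)/α). If 0 < β ≤ (1 − √α)ε/(1 + ε) and β ln(e/β) ≤ (ε/2)(√(1 − √α) − √(αε/2))², then P(Ω_{ε,β}) ≥ 1 − 3e^{−α(ε²/4 − ε³/6)m} for every m ∈ ℕ. -/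
open MeasureTheory ProbabilityTheory Real

/-- The law of an `m × n` Gaussian random matrix with i.i.d. `N(0,1)` entries. -/
noncomputable def gaussianMatrix (m n : ℕ) : Measure (Fin m → Fin n → ℝ) :=
  Measure.pi fun _ => Measure.pi fun _ => gaussianReal 0 1

/-- `‖A_T x‖²`. -/
noncomputable def subNormSq {m n : ℕ} (A : Fin m → Fin n → ℝ) (x : Fin n → ℝ)
    (T : Finset (Fin m)) : ℝ :=
  ∑ i ∈ T, (∑ j, A i j * x j) ^ 2

/-- The event `Ω_{ε,β}`. -/
def omegaEvent (m n : ℕ) (x₀ : Fin n → ℝ) (ε β : ℝ) : Set (Fin m → Fin n → ℝ) :=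
  {A | ∀ T : Finset (Fin m), (Tᶜ.card : ℝ) ≤ β * m →
    |(1 / (T.card : ℝ)) * subNormSq A x₀ T - 1| ≤ ε}

/-- A linear form with unit coefficient vector has the standard normal law under i.i.d. standard
normal coordinates. -/
theorem map_sum_mul_pi_gaussianReal {n : ℕ} (a : Fin n → ℝ) (ha : ∑ j, a j ^ 2 = 1) :
    (Measure.pi fun _ : Fin n => gaussianReal 0 1).map (fun y => ∑ j, y j * a j) =
      gaussianReal 0 1 := by
  have hmeas : Measurable (fun y : Fin n → ℝ => ∑ j, y j * a j) := by fun_prop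
  have : IsProbabilityMeasure ((Measure.pi fun _ : Fin n => gaussianReal 0 1).map
      (fun y => ∑ j, y j * a j)) := Measure.isProbabilityMeasure_map hmeas.aemeasurable
  apply Measure.ext_of_charFun
  ext t
  rw [charFun_apply_real, integral_map hmeas.aemeasurable (by fun_prop)]
  have h1 : ∀ y : Fin n → ℝ,
      Complex.exp ((t : ℂ) * ((∑ j, y j * a j : ℝ) : ℂ) * Complex.I) =
        ∏ j, Complex.exp (((t * a j : ℝ) : ℂ) * (y j : ℂ) * Complex.I) := by
    intro y
    rw [← Complex.exp_sum]
    congr 1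
    push_cast
    rw [Finset.mul_sum, Finset.sum_mul]
    exact Finset.sum_congr rfl fun j _ => by ring
  simp_rw [h1]
  rw [integral_fintype_prod_eq_prod
    (fun j (x : ℝ) => Complex.exp (((t * a j : ℝ) : ℂ) * (x : ℂ) * Complex.I))]
  simp_rw [← charFun_apply_real, charFun_gaussianReal]
  rw [← Complex.exp_sum]
  congr 1
  have h2 : (∑ j, (a j : ℂ) ^ 2) = 1 := by exact_mod_cast ha
  push_cast
  simp only [mul_zero, zero_mul, zero_sub, one_mul]
  rw [Finset.sum_neg_distrib, ← Finset.sum_div]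
  simp_rw [mul_pow]
  rw [← Finset.mul_sum, h2, mul_one]

theorem lintegral_prod_pi {m : ℕ} {E : Type*} [MeasurableSpace E] (μ : Measure E)
    [IsProbabilityMeasure μ] (g : E → ENNReal) (hg : Measurable g) :
    ∫⁻ y, ∏ i : Fin m, g (y i) ∂(Measure.pi fun _ => μ) = (∫⁻ x, g x ∂μ) ^ m := by
  have hind : iIndepFun (fun (i : Fin m) (y : Fin m → E) => g (y i)) (Measure.pi fun _ => μ) :=
    iIndepFun_pi (X := fun _ => g) fun _ => hg.aemeasurable
  rw [lintegral_prod_eq_prod_lintegral_of_indepFun Finset.univ _ hind (fun i => by fun_prop)]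
  have : ∀ i : Fin m, ∫⁻ y : Fin m → E, g (y i) ∂(Measure.pi fun _ => μ) = ∫⁻ x, g x ∂μ :=
    fun i => (measurePreserving_eval (fun _ : Fin m => μ) i).lintegral_comp hg
  simp [this]

/-- Chernoff bound for a sum of a function of the coordinates of `A x₀`. -/
theorem gaussianMatrix_chernoff {m n : ℕ} {x₀ : Fin n → ℝ} (hx₀ : ∑ j, x₀ j ^ 2 = 1)
    {h : ℝ → ℝ} (hh : Measurable h) {M : ℝ}
    (hM : ∫⁻ x, ENNReal.ofReal (exp (h x)) ∂(gaussianReal 0 1) ≤ ENNReal.ofReal (exp M)) (a : ℝ) :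
    gaussianMatrix m n {A | a ≤ ∑ i, h (∑ j, A i j * x₀ j)} ≤ ENNReal.ofReal (exp (m * M - a)) := by
  set f : (Fin n → ℝ) → ℝ := fun y => ∑ j, y j * x₀ j with hf
  have hfm : Measurable f := by fun_prop
  have h1 : ∫⁻ A, ENNReal.ofReal (exp (∑ i, h (f (A i)))) ∂(gaussianMatrix m n) ≤
      ENNReal.ofReal (exp (m * M)) := by
    have h2 : ∀ A : Fin m → Fin n → ℝ, ENNReal.ofReal (exp (∑ i, h (f (A i)))) =
        ∏ i, ENNReal.ofReal (exp (h (f (A i)))) := fun A => by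
      rw [exp_sum, ENNReal.ofReal_prod_of_nonneg fun _ _ => (exp_pos _).le]
    simp_rw [h2, gaussianMatrix]
    rw [lintegral_prod_pi _ (fun y => ENNReal.ofReal (exp (h (f y)))) (by fun_prop),
      ← lintegral_map (f := fun x => ENNReal.ofReal (exp (h x))) (by fun_prop) hfm,
      map_sum_mul_pi_gaussianReal x₀ hx₀, exp_nat_mul, ENNReal.ofReal_pow (exp_pos _).le]
    gcongr
  have hsub : {A : Fin m → Fin n → ℝ | a ≤ ∑ i, h (f (A i))} ⊆
      {A | ENNReal.ofReal (exp a) ≤ ENNReal.ofReal (exp (∑ i, h (f (A i))))} := fun A hA =>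
    ENNReal.ofReal_le_ofReal (exp_le_exp.2 hA)
  refine (measure_mono hsub).trans ((meas_ge_le_lintegral_div
    (Measurable.aemeasurable (by fun_prop)) (by simp [exp_pos])
    (by simp)).trans ?_)
  rw [exp_sub, ENNReal.ofReal_div_of_pos (exp_pos _)]
  gcongr

/-- Moment generating function of the square of a standard normal variable. -/
theorem lintegral_exp_mul_sq_gaussianReal {r : ℝ} (hr : r < 1 / 2) :
    ∫⁻ x, ENNReal.ofReal (exp (r * x ^ 2)) ∂(gaussianReal 0 1) =
      ENNReal.ofReal (exp (-(log (1 - 2 * r) / 2))) := by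
  have hb : 0 < 1 / 2 - r := by linarith
  rw [gaussianReal_of_var_ne_zero _ one_ne_zero,
    lintegral_withDensity_eq_lintegral_mul _ (measurable_gaussianPDF _ _) (by fun_prop)]
  have h1 : ∀ x : ℝ, (gaussianPDF 0 1 * fun x => ENNReal.ofReal (exp (r * x ^ 2))) x =
      ENNReal.ofReal ((√(2 * π))⁻¹ * exp (-(1 / 2 - r) * x ^ 2)) := by
    intro x
    rw [Pi.mul_apply, gaussianPDF, ← ENNReal.ofReal_mul (gaussianPDFReal_nonneg _ _ _),
      gaussianPDFReal, mul_assoc, ← exp_add]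
    simp only [NNReal.coe_one, mul_one, sub_zero]
    congr 3
    ring
  simp_rw [h1]
  rw [← ofReal_integral_eq_lintegral_ofReal ((integrable_exp_neg_mul_sq hb).const_mul _)
    (ae_of_all _ fun x => by positivity), integral_const_mul, integral_gaussian]
  congr 1
  rw [exp_neg, ← log_sqrt (by linarith), exp_log (sqrt_pos.2 (by linarith)), ← sqrt_inv,
    ← sqrt_inv, ← sqrt_mul (by positivity)]
  congr 1
  have : (1 - 2 * r) ≠ 0 := by linarith
  field_simp

theorem lintegral_Ioi_ofReal_deriv {f f' : ℝ → ℝ} {a l : ℝ}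
    (hf : ∀ x, HasDerivAt f (f' x) x) (hpos : ∀ x ∈ Set.Ioi a, 0 ≤ f' x)
    (hl : Filter.Tendsto f Filter.atTop (nhds l)) :
    ∫⁻ x in Set.Ioi a, ENNReal.ofReal (f' x) = ENNReal.ofReal (l - f a) := by
  rw [← integral_Ioi_of_hasDerivAt_of_nonneg' (fun x _ => hf x) hpos hl,
    ofReal_integral_eq_lintegral_ofReal
      (integrableOn_Ioi_deriv_of_nonneg' (fun x _ => hf x) hpos hl)]
  exact (ae_restrict_iff' measurableSet_Ioi).2 (ae_of_all _ hpos)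

theorem hasDerivAt_exp_neg_mul_sq_half (k x : ℝ) :
    HasDerivAt (fun x => exp (-(k * (x ^ 2 / 2)))) (-(k * x * exp (-(k * (x ^ 2 / 2))))) x := by
  have h : HasDerivAt (fun x : ℝ => -(k * (x ^ 2 / 2))) (-(k * (2 * x / 2))) x := by
    refine (((hasDerivAt_pow 2 x).div_const 2).const_mul k).neg.congr_deriv ?_
    norm_num
  exact h.exp.congr_deriv (by ring)

theorem lintegral_Ioi_mul_exp_neg_sq_half :
    ∫⁻ x in Set.Ioi (0 : ℝ), ENNReal.ofReal (x * exp (-(x ^ 2 / 2))) = 1 := by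
  rw [lintegral_Ioi_ofReal_deriv (f := fun x => -exp (-(x ^ 2 / 2))) (l := 0)]
  · simp
  · intro x
    have h := (hasDerivAt_exp_neg_mul_sq_half 1 x).neg
    simp only [one_mul, neg_neg] at h
    exact h
  · intro x hx
    have : (0 : ℝ) < x := hx
    positivity
  · rw [← neg_zero]
    refine (tendsto_exp_neg_atTop_nhds_zero.comp ?_).neg
    exact (Filter.tendsto_pow_atTop two_ne_zero).atTop_div_const (by norm_num)

theorem lintegral_Ioi_mul_exp_sub_exp {q s : ℝ} (hq : 0 ≤ q) (hs0 : 0 ≤ s) (hs1 : s < 1) :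
    ∫⁻ x in Set.Ioi q, ENNReal.ofReal
      (x * exp (-(x ^ 2 / 2)) * (exp (s / 2 * (x ^ 2 - q ^ 2)) - 1)) =
        ENNReal.ofReal (exp (-(q ^ 2 / 2)) * (s / (1 - s))) := by
  have hy : 0 < 1 - s := by linarith
  have hsq : Filter.Tendsto (fun x : ℝ => x ^ 2 / 2) Filter.atTop Filter.atTop :=
    (Filter.tendsto_pow_atTop two_ne_zero).atTop_div_const (by norm_num)
  rw [lintegral_Ioi_ofReal_deriv (l := 0) (f := fun x => exp (-(x ^ 2 / 2)) -
    (1 - s)⁻¹ * exp (-(s / 2 * q ^ 2)) * exp (-((1 - s) * (x ^ 2 / 2))))]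
  · congr 1
    rw [mul_assoc, ← exp_add]
    have : -(s / 2 * q ^ 2) + -((1 - s) * (q ^ 2 / 2)) = -(q ^ 2 / 2) := by ring
    rw [this]
    field_simp
    ring
  · intro x
    have h1 := hasDerivAt_exp_neg_mul_sq_half 1 x
    have h2 := (hasDerivAt_exp_neg_mul_sq_half (1 - s) x).const_mul
      ((1 - s)⁻¹ * exp (-(s / 2 * q ^ 2)))
    simp only [one_mul] at h1
    refine (h1.sub h2).congr_deriv ?_
    have h3 : exp (-(x ^ 2 / 2)) * exp (s / 2 * (x ^ 2 - q ^ 2)) =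
        exp (-(s / 2 * q ^ 2)) * exp (-((1 - s) * (x ^ 2 / 2))) := by
      rw [← exp_add, ← exp_add]
      congr 1
      ring
    have h4 : (1 - s)⁻¹ * (1 - s) = 1 := inv_mul_cancel₀ hy.ne'
    linear_combination x * exp (-(s / 2 * q ^ 2)) * exp (-((1 - s) * (x ^ 2 / 2))) * h4 - x * h3
  · intro x hx
    have hx' : q < x := hx
    have hsub : 0 ≤ x ^ 2 - q ^ 2 := by nlinarith
    have : 1 ≤ exp (s / 2 * (x ^ 2 - q ^ 2)) := one_le_exp (by positivity)
    have hx0 : 0 ≤ x := hq.trans hx'.le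
    exact mul_nonneg (by positivity) (by linarith)
  · have h1 := tendsto_exp_neg_atTop_nhds_zero.comp hsq
    have h2 := (tendsto_exp_neg_atTop_nhds_zero.comp (hsq.const_mul_atTop hy)).const_mul
      ((1 - s)⁻¹ * exp (-(s / 2 * q ^ 2)))
    simpa using h1.sub h2

/-- Comparison of the square of a standard normal variable with the squared norm of a planar one,
written in polar coordinates. -/
theorem lintegral_sq_gaussianReal_le {G : ℝ → ℝ} (hG : Monotone G) (hG0 : ∀ s, 0 ≤ G s) :
    ∫⁻ x, ENNReal.ofReal (G (x ^ 2)) ∂(gaussianReal 0 1) ≤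
      ∫⁻ r in Set.Ioi (0 : ℝ), ENNReal.ofReal (r * exp (-(r ^ 2 / 2)) * G (r ^ 2)) := by
  have hGm : Measurable G := hG.measurable
  have hd : ∀ x y : ℝ,
      gaussianPDF 0 1 x * (gaussianPDF 0 1 y * ENNReal.ofReal (G (x ^ 2 + y ^ 2))) =
      ENNReal.ofReal ((2 * π)⁻¹ * exp (-((x ^ 2 + y ^ 2) / 2)) * G (x ^ 2 + y ^ 2)) := by
    intro x y
    rw [gaussianPDF, gaussianPDF, ← ENNReal.ofReal_mul (gaussianPDFReal_nonneg _ _ _),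
      ← ENNReal.ofReal_mul (gaussianPDFReal_nonneg _ _ _), ← mul_assoc]
    congr 2
    simp only [gaussianPDFReal, NNReal.coe_one, mul_one, sub_zero]
    rw [mul_mul_mul_comm, ← exp_add, ← mul_inv, mul_self_sqrt (by positivity)]
    congr 2
    ring
  calc ∫⁻ x, ENNReal.ofReal (G (x ^ 2)) ∂(gaussianReal 0 1)
      ≤ ∫⁻ x, ∫⁻ y, ENNReal.ofReal (G (x ^ 2 + y ^ 2)) ∂(gaussianReal 0 1) ∂(gaussianReal 0 1) := by
        refine lintegral_mono fun x => ?_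
        calc ENNReal.ofReal (G (x ^ 2)) = ∫⁻ _, ENNReal.ofReal (G (x ^ 2)) ∂(gaussianReal 0 1) := by
              simp
          _ ≤ _ := lintegral_mono fun y =>
              ENNReal.ofReal_le_ofReal (hG (le_add_of_nonneg_right (sq_nonneg y)))
    _ = ∫⁻ x, ∫⁻ y, ENNReal.ofReal
          ((2 * π)⁻¹ * exp (-((x ^ 2 + y ^ 2) / 2)) * G (x ^ 2 + y ^ 2)) := by
        rw [gaussianReal_of_var_ne_zero _ one_ne_zero, lintegral_withDensity_eq_lintegral_mul₀
          (measurable_gaussianPDF _ _).aemeasurable]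
        · refine lintegral_congr fun x => ?_
          rw [Pi.mul_apply, lintegral_withDensity_eq_lintegral_mul _ (measurable_gaussianPDF _ _)
            (by fun_prop), ← lintegral_const_mul _ ((measurable_gaussianPDF _ _).mul (by fun_prop))]
          exact lintegral_congr fun y => hd x y
        · exact (Measurable.lintegral_prod_right'
            (f := fun p : ℝ × ℝ => ENNReal.ofReal (G (p.1 ^ 2 + p.2 ^ 2)))
            (by fun_prop)).aemeasurable
    _ = ∫⁻ p : ℝ × ℝ, ENNReal.ofReal
          ((2 * π)⁻¹ * exp (-((p.1 ^ 2 + p.2 ^ 2) / 2)) * G (p.1 ^ 2 + p.2 ^ 2)) := by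
        rw [Measure.volume_eq_prod, lintegral_prod _ (by fun_prop)]
    _ = ∫⁻ p in Set.Ioi (0 : ℝ) ×ˢ Set.Ioo (-π) π, ENNReal.ofReal
          (p.1 * ((2 * π)⁻¹ * exp (-(p.1 ^ 2 / 2)) * G (p.1 ^ 2))) := by
        rw [← lintegral_comp_polarCoord_symm, polarCoord_target]
        refine setLIntegral_congr_fun (measurableSet_Ioi.prod measurableSet_Ioo) fun p hp => ?_
        have hp1 : (0 : ℝ) < p.1 := hp.1
        have : (p.1 * cos p.2) ^ 2 + (p.1 * sin p.2) ^ 2 = p.1 ^ 2 := by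
          linear_combination p.1 ^ 2 * sin_sq_add_cos_sq p.2
        simp only [polarCoord_symm_apply, smul_eq_mul]
        rw [this, ENNReal.ofReal_mul hp1.le]
    _ = ∫⁻ r in Set.Ioi (0 : ℝ), ENNReal.ofReal (r * exp (-(r ^ 2 / 2)) * G (r ^ 2)) := by
        rw [Measure.volume_eq_prod, ← Measure.prod_restrict, lintegral_prod _ (by fun_prop)]
        refine setLIntegral_congr_fun measurableSet_Ioi fun r hr => ?_
        have hr0 : (0 : ℝ) < r := hr
        simp only [lintegral_const, Measure.restrict_apply, MeasurableSet.univ, Set.univ_inter,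
          Real.volume_Ioo]
        rw [← ENNReal.ofReal_mul (by have := hG0 (r ^ 2); positivity)]
        congr 1
        have := pi_pos
        field_simp
        ring

theorem lintegral_exp_max_sq_sub_gaussianReal {c s : ℝ} (hc : 0 ≤ c) (hs0 : 0 ≤ s) (hs1 : s < 1) :
    ∫⁻ x, ENNReal.ofReal (exp (s / 2 * max (x ^ 2 - c) 0)) ∂(gaussianReal 0 1) ≤
      ENNReal.ofReal (exp (exp (-(c / 2)) * (s / (1 - s)))) := by
  have hmono : Monotone fun t : ℝ => exp (s / 2 * max (t - c) 0) := fun a b hab => by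
    dsimp only
    gcongr
  refine (lintegral_sq_gaussianReal_le hmono fun _ => (exp_pos _).le).trans ?_
  obtain ⟨q, hq, rfl⟩ : ∃ q : ℝ, 0 ≤ q ∧ c = q ^ 2 := ⟨√c, sqrt_nonneg c, (sq_sqrt hc).symm⟩
  have hy : 0 < 1 - s := by linarith
  set B : ℝ → ENNReal := fun x => ENNReal.ofReal
      (x * exp (-(x ^ 2 / 2)) * (exp (s / 2 * (x ^ 2 - q ^ 2)) - 1)) with hB
  calc ∫⁻ r in Set.Ioi (0 : ℝ), ENNReal.ofReal
        (r * exp (-(r ^ 2 / 2)) * exp (s / 2 * max (r ^ 2 - q ^ 2) 0))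
      ≤ ∫⁻ r in Set.Ioi (0 : ℝ), (ENNReal.ofReal (r * exp (-(r ^ 2 / 2))) +
          (Set.Ioi q).indicator B r) := by
        refine setLIntegral_mono' measurableSet_Ioi fun r hr => ?_
        have hr0 : (0 : ℝ) < r := hr
        by_cases hrq : q < r
        · have h0 : 0 ≤ r ^ 2 - q ^ 2 := by nlinarith
          have h1 : 1 ≤ exp (s / 2 * (r ^ 2 - q ^ 2)) := one_le_exp (by positivity)
          rw [Set.indicator_of_mem (show r ∈ Set.Ioi q from hrq), hB, max_eq_left h0,
            ← ENNReal.ofReal_add (by positivity) (mul_nonneg (by positivity) (by linarith))]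
          apply le_of_eq
          congr 1
          ring
        · have h0 : r ^ 2 - q ^ 2 ≤ 0 := by nlinarith
          rw [max_eq_right h0]
          simp
    _ = 1 + ∫⁻ r in Set.Ioi (0 : ℝ), (Set.Ioi q).indicator B r := by
        rw [lintegral_add_left (by fun_prop), lintegral_Ioi_mul_exp_neg_sq_half]
    _ ≤ 1 + ∫⁻ r, (Set.Ioi q).indicator B r := by
        gcongr
        exact Measure.restrict_le_self
    _ = ENNReal.ofReal (1 + exp (-(q ^ 2 / 2)) * (s / (1 - s))) := by
        rw [lintegral_indicator measurableSet_Ioi, lintegral_Ioi_mul_exp_sub_exp hq hs0 hs1,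
          ENNReal.ofReal_add zero_le_one (by positivity), ENNReal.ofReal_one]
    _ ≤ _ := ENNReal.ofReal_le_ofReal (by rw [add_comm]; exact add_one_le_exp _)

theorem log_one_add_le_cubic {x : ℝ} (hx : 0 ≤ x) : log (1 + x) ≤ x - x ^ 2 / 2 + x ^ 3 / 3 := by
  have hder : ∀ z : ℝ, 0 ≤ z → HasDerivAt (fun z => z - z ^ 2 / 2 + z ^ 3 / 3 - log (1 + z))
      (z ^ 3 / (1 + z)) z := by
    intro z hz
    have h0 : 1 + z ≠ 0 := by positivity
    have := (((hasDerivAt_id z).sub ((hasDerivAt_pow 2 z).div_const 2)).add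
      ((hasDerivAt_pow 3 z).div_const 3)).sub (((hasDerivAt_id z).const_add 1).log h0)
    refine this.congr_deriv ?_
    simp only [id]
    field_simp
    norm_num
    ring
  have hmono : MonotoneOn (fun z : ℝ => z - z ^ 2 / 2 + z ^ 3 / 3 - log (1 + z)) (Set.Ici 0) := by
    refine monotoneOn_of_hasDerivWithinAt_nonneg (f' := fun z => z ^ 3 / (1 + z)) (convex_Ici 0)
      (fun z hz => (hder z hz).continuousAt.continuousWithinAt)
      (fun z hz => (hder z (interior_subset hz)).hasDerivWithinAt) fun z hz => ?_
    have : (0 : ℝ) ≤ z := interior_subset hz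
    positivity
  have := hmono (Set.mem_Ici.2 le_rfl) (Set.mem_Ici.2 hx) hx
  simp at this
  linarith

theorem log_one_sub_le_quadratic {x : ℝ} (hx0 : 0 ≤ x) (hx1 : x < 1) :
    log (1 - x) ≤ -x - x ^ 2 / 2 := by
  have := sum_le_hasSum (Finset.range 2) (fun i _ => by positivity)
    (hasSum_pow_div_log_of_abs_lt_one (x := x) (by rwa [abs_of_nonneg hx0]))
  norm_num [Finset.sum_range_succ] at this
  linarith

theorem truncation_exponent_le {β w t : ℝ} (hβ0 : 0 < β) (hw : 0 ≤ w)
    (ht : 2 * (β * (1 - log β)) + 2 * (β * w ^ 2) + 4 * (β * w) ≤ t) :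
    exp (-(-2 * log (β / (1 + w)) / 2)) * (w / (1 + w) / (1 - w / (1 + w))) -
      w / (1 + w) / 2 * (t - β * (-2 * log (β / (1 + w)))) ≤ -(β * w ^ 2) := by
  have h1 : 0 < 1 + w := by positivity
  have hlog : log (1 + w) ≤ w := by linarith [log_le_sub_one_of_pos h1]
  have he : -(-2 * log (β / (1 + w)) / 2) = log (β / (1 + w)) := by ring
  have hs : w / (1 + w) / (1 - w / (1 + w)) = w := by
    have : 1 - w / (1 + w) = 1 / (1 + w) := by field_simp; ring
    rw [this]
    field_simp
  rw [he, hs, exp_log (by positivity), log_div hβ0.ne' h1.ne']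
  have hmain : 2 * β + 2 * (β * w ^ 2) + 2 * (β * w) ≤
      t - β * (-2 * (log β - log (1 + w))) := by
    nlinarith [mul_le_mul_of_nonneg_left hlog hβ0.le]
  have := mul_le_mul_of_nonneg_left hmain (show 0 ≤ w / (1 + w) / 2 by positivity)
  have heq : w / (1 + w) / 2 * (2 * β + 2 * (β * w ^ 2) + 2 * (β * w)) =
      β / (1 + w) * w + β * w ^ 2 := by
    field_simp
    ring
  linarith

theorem abs_average_sub_one_le {m : ℕ} (hm : 0 < m) {z : Fin m → ℝ} (hz : ∀ i, 0 ≤ z i)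
    {ε δ β c : ℝ} (hε0 : 0 < ε) (hε1 : ε ≤ 1) (hc : 0 ≤ c) (hβ : β * (1 + ε) ≤ ε - δ)
    (hub : ∑ i, z i < (1 + δ) * m) (hlb : (1 - δ) * m < ∑ i, z i)
    (htr : ∑ i, max (z i - c) 0 < m * (ε - δ - β * c))
    {T : Finset (Fin m)} (hT : (Tᶜ.card : ℝ) ≤ β * m) :
    |1 / (T.card : ℝ) * ∑ i ∈ T, z i - 1| ≤ ε := by
  have hm' : (0 : ℝ) < m := by exact_mod_cast hm
  have hcard : (T.card : ℝ) + Tᶜ.card = m := by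
    have := T.card_add_card_compl
    rw [Fintype.card_fin] at this
    exact_mod_cast this
  have hsplit := Finset.sum_add_sum_compl T z
  have hβ1 : β < 1 := by nlinarith
  have hTpos : (0 : ℝ) < T.card := by nlinarith
  have hcompl0 : 0 ≤ ∑ i ∈ Tᶜ, z i := Finset.sum_nonneg fun i _ => hz i
  have hcompl : ∑ i ∈ Tᶜ, z i ≤ Tᶜ.card * c + ∑ i, max (z i - c) 0 := by
    calc ∑ i ∈ Tᶜ, z i ≤ ∑ i ∈ Tᶜ, (c + max (z i - c) 0) :=
          Finset.sum_le_sum fun i _ => by linarith [le_max_left (z i - c) 0]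
      _ = Tᶜ.card * c + ∑ i ∈ Tᶜ, max (z i - c) 0 := by
          rw [Finset.sum_add_distrib, Finset.sum_const, nsmul_eq_mul]
      _ ≤ _ := by
          gcongr
          exact Finset.subset_univ _
  have hcc := mul_le_mul_of_nonneg_right hT hc
  have hcε : 0 ≤ (Tᶜ.card : ℝ) * (1 - ε) := mul_nonneg (Nat.cast_nonneg _) (by linarith)
  have hdiv : 1 / (T.card : ℝ) * ∑ i ∈ T, z i - 1 = (∑ i ∈ T, z i - T.card) / T.card := by
    field_simp
  rw [hdiv, abs_div, abs_of_pos hTpos, div_le_iff₀ hTpos, abs_le]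
  constructor
  · nlinarith
  · have h1 := mul_le_mul_of_nonneg_right hT (show 0 ≤ 1 + ε by linarith)
    have h2 := mul_le_mul_of_nonneg_right hβ hm'.le
    nlinarith

theorem truncation_threshold {α ε β : ℝ} (hα0 : 0 < α) (hε0 : 0 < ε)
    (hε2 : ε ≤ 2 * (1 - √α) / α) (hβ0 : 0 < β) (hβ1 : β ≤ 1)
    (hβ2 : β * log (exp 1 / β) ≤ ε / 2 * (√(1 - √α) - √(α * ε / 2)) ^ 2) {w : ℝ} (hw : 0 ≤ w)
    (hw2 : β * w ^ 2 = α * ε ^ 2 / 4) :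
    2 * (β * (1 - log β)) + 2 * (β * w ^ 2) + 4 * (β * w) ≤ ε - √α * ε := by
  have hle : α * ε / 2 ≤ 1 - √α := by
    rw [le_div_iff₀ hα0] at hε2
    linarith
  have hqp := sqrt_le_sqrt hle
  have hp2 := sq_sqrt (show 0 ≤ 1 - √α from (show 0 ≤ α * ε / 2 by positivity).trans hle)
  have hq2 := sq_sqrt (show 0 ≤ α * ε / 2 by positivity)
  rw [log_div (exp_pos 1).ne' hβ0.ne', log_exp] at hβ2
  have hq0 := sqrt_nonneg (α * ε / 2)
  set p := √(1 - √α)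
  set q := √(α * ε / 2)
  have hL : β ≤ β * (1 - log β) := by nlinarith [log_nonpos hβ0.le hβ1]
  have hsq : (2 * (β * w)) ^ 2 ≤ (ε * q * (p - q)) ^ 2 := by
    have h1 : (2 * (β * w)) ^ 2 = 2 * β * (ε * q ^ 2) := by
      rw [hq2]; linear_combination 4 * β * hw2
    have h2 : (ε * q * (p - q)) ^ 2 = ε * (p - q) ^ 2 * (ε * q ^ 2) := by ring
    rw [h1, h2]
    exact mul_le_mul_of_nonneg_right (by linarith) (by positivity)
  have hroot := (pow_le_pow_iff_left₀ (by positivity)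
    (mul_nonneg (by positivity) (by linarith)) two_ne_zero).1 hsq
  nlinarith

theorem gaussianMatrix_add_mul_le_sum_sq {m n : ℕ} {x₀ : Fin n → ℝ} (hx₀ : ∑ j, x₀ j ^ 2 = 1)
    {δ : ℝ} (hδ : 0 ≤ δ) :
    gaussianMatrix m n {A | (1 + δ) * m ≤ ∑ i, (∑ j, A i j * x₀ j) ^ 2} ≤
      ENNReal.ofReal (exp (-(δ ^ 2 / 4 - δ ^ 3 / 6) * m)) := by
  have h1 : 0 < 1 + δ := by linarith
  have hr : δ / (2 * (1 + δ)) < 1 / 2 := by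
    rw [div_lt_div_iff₀ (by positivity) two_pos]; linarith
  have hlog : 1 - 2 * (δ / (2 * (1 + δ))) = (1 + δ)⁻¹ := by field_simp; ring
  have hch := gaussianMatrix_chernoff (m := m) hx₀
    (h := fun x => δ / (2 * (1 + δ)) * x ^ 2) (by fun_prop)
    (lintegral_exp_mul_sq_gaussianReal hr).le (m * (δ / 2))
  refine (measure_mono fun A hA => ?_).trans (hch.trans (ENNReal.ofReal_le_ofReal ?_))
  · have := mul_le_mul_of_nonneg_left hA.out (show 0 ≤ δ / (2 * (1 + δ)) by positivity)
    simp only [Set.mem_ofPred_eq, ← Finset.mul_sum]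
    refine le_trans (le_of_eq ?_) this
    field_simp
  · rw [hlog, log_inv, exp_le_exp]
    nlinarith [mul_le_mul_of_nonneg_left (log_one_add_le_cubic hδ) (Nat.cast_nonneg (α := ℝ) m)]

theorem gaussianMatrix_sum_sq_le_sub_mul {m n : ℕ} {x₀ : Fin n → ℝ} (hx₀ : ∑ j, x₀ j ^ 2 = 1)
    {δ : ℝ} (hδ : 0 ≤ δ) (hδ1 : δ < 1) :
    gaussianMatrix m n {A | ∑ i, (∑ j, A i j * x₀ j) ^ 2 ≤ (1 - δ) * m} ≤
      ENNReal.ofReal (exp (-(δ ^ 2 / 4) * m)) := by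
  have h1 : 0 < 1 - δ := by linarith
  have hr0 : 0 ≤ δ / (2 * (1 - δ)) := by positivity
  have hlog : 1 - 2 * (-(δ / (2 * (1 - δ)))) = (1 - δ)⁻¹ := by field_simp; ring
  have hch := gaussianMatrix_chernoff (m := m) hx₀
    (h := fun x => -(δ / (2 * (1 - δ))) * x ^ 2) (by fun_prop)
    (lintegral_exp_mul_sq_gaussianReal (by linarith)).le (-(m * (δ / 2)))
  refine (measure_mono fun A hA => ?_).trans (hch.trans (ENNReal.ofReal_le_ofReal ?_))
  · have := mul_le_mul_of_nonneg_left hA.out hr0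
    rw [Set.mem_ofPred_eq, ← Finset.mul_sum, neg_mul, neg_le_neg_iff]
    refine this.trans (le_of_eq ?_)
    field_simp
  · rw [hlog, log_inv, exp_le_exp]
    nlinarith [mul_le_mul_of_nonneg_left (log_one_sub_le_quadratic hδ hδ1)
      (Nat.cast_nonneg (α := ℝ) m)]

theorem gaussianMatrix_le_sum_max_sq_sub {m n : ℕ} {x₀ : Fin n → ℝ} (hx₀ : ∑ j, x₀ j ^ 2 = 1)
    {β w t : ℝ} (hβ0 : 0 < β) (hβ1 : β ≤ 1) (hw : 0 ≤ w)
    (ht : 2 * (β * (1 - log β)) + 2 * (β * w ^ 2) + 4 * (β * w) ≤ t) :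
    gaussianMatrix m n {A | m * (t - β * (-2 * log (β / (1 + w)))) ≤
      ∑ i, max ((∑ j, A i j * x₀ j) ^ 2 - -2 * log (β / (1 + w))) 0} ≤
      ENNReal.ofReal (exp (-(β * w ^ 2) * m)) := by
  have h1 : 0 < 1 + w := by linarith
  have hc : 0 ≤ -2 * log (β / (1 + w)) := by
    have : β / (1 + w) ≤ 1 := (div_le_one h1).2 (by linarith)
    linarith [log_nonpos (by positivity) this]
  have hs : w / (1 + w) < 1 := (div_lt_one h1).2 (by linarith)
  have hexp := truncation_exponent_le hβ0 hw ht
  set c := -2 * log (β / (1 + w))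
  have hch := gaussianMatrix_chernoff (m := m) hx₀
    (h := fun x => w / (1 + w) / 2 * max (x ^ 2 - c) 0) (by fun_prop)
    (lintegral_exp_max_sq_sub_gaussianReal hc (by positivity) hs)
    (w / (1 + w) / 2 * (m * (t - β * c)))
  refine (measure_mono fun A hA => ?_).trans (hch.trans (ENNReal.ofReal_le_ofReal ?_))
  · simp only [Set.mem_ofPred_eq, ← Finset.mul_sum]
    exact mul_le_mul_of_nonneg_left hA.out (by positivity)
  · rw [exp_le_exp]
    linarith [mul_le_mul_of_nonneg_left hexp (Nat.cast_nonneg (α := ℝ) m)]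

theorem omegaEvent_prob_lower (n : ℕ) (x₀ : Fin n → ℝ) (hx₀ : ∑ j, x₀ j ^ 2 = 1)
    (α : ℝ) (hα0 : 0 < α) (hα1 : α < 1)
    (ε : ℝ) (hε0 : 0 < ε) (hε1 : ε ≤ min 1 (2 * (1 - Real.sqrt α) / α))
    (β : ℝ) (hβ0 : 0 < β)
    (hβ1 : β ≤ (1 - Real.sqrt α) * ε / (1 + ε))
    (hβ2 : β * Real.log (Real.exp 1 / β) ≤
      (ε / 2) * (Real.sqrt (1 - Real.sqrt α) - Real.sqrt (α * ε / 2)) ^ 2) :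
    ∀ m : ℕ, 0 < m →
      ENNReal.ofReal (1 - 3 * Real.exp (-α * (ε ^ 2 / 4 - ε ^ 3 / 6) * m)) ≤
        gaussianMatrix m n (omegaEvent m n x₀ ε β) := by
  intro m hm
  have hε1' : ε ≤ 1 := hε1.trans (min_le_left _ _)
  have hs0 : 0 < √α := sqrt_pos.2 hα0
  have hs1 : √α < 1 := by rw [sqrt_lt' one_pos]; simpa using hα1
  have hs2 : √α ^ 2 = α := sq_sqrt hα0.le
  have hβ1' : β * (1 + ε) ≤ ε - √α * ε := by
    rw [le_div_iff₀ (by linarith)] at hβ1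
    linarith
  have hβle : β ≤ 1 := by nlinarith
  obtain ⟨w, hw, hw2⟩ : ∃ w : ℝ, 0 ≤ w ∧ β * w ^ 2 = α * ε ^ 2 / 4 :=
    ⟨√(α * ε ^ 2 / 4 / β), sqrt_nonneg _, by
      rw [sq_sqrt (by positivity)]
      field_simp⟩
  have ht := truncation_threshold hα0 hε0 (hε1.trans (min_le_right _ _)) hβ0 hβle hβ2 hw hw2
  have hδ0 : 0 ≤ √α * ε := by positivity
  have hδ1 : √α * ε < 1 := by nlinarith
  have h1 := gaussianMatrix_add_mul_le_sum_sq (m := m) hx₀ hδ0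
  have h2 := gaussianMatrix_sum_sq_le_sub_mul (m := m) hx₀ hδ0 hδ1
  have h3 := gaussianMatrix_le_sum_max_sq_sub (m := m) hx₀ hβ0 hβle hw ht
  have hc : 0 ≤ -2 * log (β / (1 + w)) := by
    have : β / (1 + w) ≤ 1 := (div_le_one (by linarith)).2 (by linarith)
    linarith [log_nonpos (by positivity) this]
  set c := -2 * log (β / (1 + w))
  set P := exp (-α * (ε ^ 2 / 4 - ε ^ 3 / 6) * m)
  have hm0 : (0 : ℝ) ≤ m := Nat.cast_nonneg m
  have hαε : 0 ≤ α * ε ^ 3 := by positivity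
  have hδ2 : (√α * ε) ^ 2 = α * ε ^ 2 := by rw [mul_pow, hs2]
  have e1 : exp (-((√α * ε) ^ 2 / 4 - (√α * ε) ^ 3 / 6) * m) ≤ P := by
    refine exp_le_exp.2 (mul_le_mul_of_nonneg_right ?_ hm0)
    have : (√α * ε) ^ 3 = √α * (α * ε ^ 3) := by
      rw [mul_pow]; linear_combination √α * ε ^ 3 * hs2
    rw [hδ2, this]
    nlinarith
  have e2 : exp (-((√α * ε) ^ 2 / 4) * m) ≤ P := by
    refine exp_le_exp.2 (mul_le_mul_of_nonneg_right ?_ hm0)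
    rw [hδ2]
    linarith
  have e3 : exp (-(β * w ^ 2) * m) ≤ P := by
    refine exp_le_exp.2 (mul_le_mul_of_nonneg_right ?_ hm0)
    rw [hw2]
    linarith
  have hP : 0 ≤ P := (exp_pos _).le
  have hcompl : gaussianMatrix m n (omegaEvent m n x₀ ε β)ᶜ ≤ ENNReal.ofReal (3 * P) := by
    have hsub : (omegaEvent m n x₀ ε β)ᶜ ⊆
        {A | (1 + √α * ε) * m ≤ ∑ i, (∑ j, A i j * x₀ j) ^ 2} ∪
        {A | ∑ i, (∑ j, A i j * x₀ j) ^ 2 ≤ (1 - √α * ε) * m} ∪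
        {A | m * (ε - √α * ε - β * c) ≤ ∑ i, max ((∑ j, A i j * x₀ j) ^ 2 - c) 0} := by
      intro A
      contrapose!
      simp only [Set.mem_union, Set.mem_ofPred_eq, not_or, not_le, Set.mem_compl_iff, not_not]
      rintro ⟨⟨hub, hlb⟩, htr⟩ T hT
      exact abs_average_sub_one_le hm (fun i => sq_nonneg _) hε0 hε1' hc hβ1' hub hlb htr hT
    have h3P : 3 * P = P + P + P := by ring
    rw [h3P, ENNReal.ofReal_add (by positivity) hP, ENNReal.ofReal_add hP hP]
    refine (measure_mono hsub).trans ((measure_union_le _ _).trans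
      (add_le_add ((measure_union_le _ _).trans (add_le_add ?_ ?_)) ?_))
    · exact h1.trans (ENNReal.ofReal_le_ofReal e1)
    · exact h2.trans (ENNReal.ofReal_le_ofReal e2)
    · exact h3.trans (ENNReal.ofReal_le_ofReal e3)
  have : IsProbabilityMeasure (gaussianMatrix m n) := by
    unfold gaussianMatrix
    infer_instance
  rw [ENNReal.ofReal_sub _ (by positivity), ENNReal.ofReal_one, tsub_le_iff_right]
  calc (1 : ENNReal) = gaussianMatrix m n (omegaEvent m n x₀ ε β ∪ (omegaEvent m n x₀ ε β)ᶜ) := by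
        rw [Set.union_compl_self, measure_univ]
    _ ≤ gaussianMatrix m n (omegaEvent m n x₀ ε β) +
          gaussianMatrix m n (omegaEvent m n x₀ ε β)ᶜ := measure_union_le _ _
    _ ≤ _ := by gcongr
end
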